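/- arXiv:1201.5790 — 2 statements merged into one kernel-verified Lean document; each statement's English description precedes it below -/
import Mathlib

section
/- Let G be a perfect graph. The Hansen polytope H(G) is a Hanner polytope if and only if G is a threshold graph. -/
/-- A finset of vertices is stable (independent) in `G` if no two of its elements are adjacent. -/
def IsStable {n : ℕ} (G : SimpleGraph (Fin n)) (I : Finset (Fin n)) : Prop :=
  ∀ ⦃a⦄, a ∈ I → ∀ ⦃b⦄, b ∈ I → ¬ G.Adj a b

/-- The point `e_0 + ∑_{i ∈ I} e_i ∈ ℝ^{n+1}`. -/
def hansenVert {n : ℕ} (I : Finset (Fin n)) : Fin (n + 1) → ℝ :=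
  fun j => Fin.cases 1 (fun i => if i ∈ I then 1 else 0) j

/-- The Hansen polytope of `G`. -/
def hansenPolytope {n : ℕ} (G : SimpleGraph (Fin n)) : Set (Fin (n + 1) → ℝ) :=
  convexHull ℝ
    {x | ∃ I : Finset (Fin n), IsStable G I ∧ (x = hansenVert I ∨ x = -hansenVert I)}

/-- The polar dual `P° = { y : ⟨y,x⟩ ≤ 1 for all x ∈ P }`. -/
def polarDual {d : ℕ} (P : Set (Fin d → ℝ)) : Set (Fin d → ℝ) :=
  {y | ∀ x ∈ P, ∑ i, y i * x i ≤ 1}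

/-- Hanner polytopes, defined recursively: a centrally symmetric segment (in dimension 1),
or anything linearly equivalent to a direct product of two Hanner polytopes, or anything
linearly equivalent to the polar dual of a Hanner polytope. -/
inductive IsHanner : (d : ℕ) → Set (Fin d → ℝ) → Prop
  | segment (v : Fin 1 → ℝ) (hv : v ≠ 0) : IsHanner 1 (segment ℝ (-v) v)
  | prod {d₁ d₂ : ℕ} {P₁ : Set (Fin d₁ → ℝ)} {P₂ : Set (Fin d₂ → ℝ)}
      (h₁ : IsHanner d₁ P₁) (h₂ : IsHanner d₂ P₂) (P : Set (Fin (d₁ + d₂) → ℝ))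
      (e : (Fin (d₁ + d₂) → ℝ) ≃ₗ[ℝ] (Fin (d₁ + d₂) → ℝ))
      (he : e '' P = {x | (fun i => x (Fin.castAdd d₂ i)) ∈ P₁ ∧
        (fun i => x (Fin.natAdd d₁ i)) ∈ P₂}) :
      IsHanner (d₁ + d₂) P
  | polar {d : ℕ} {P : Set (Fin d → ℝ)} (h : IsHanner d P) (Q : Set (Fin d → ℝ))
      (e : (Fin d → ℝ) ≃ₗ[ℝ] (Fin d → ℝ)) (he : e '' Q = polarDual P) : IsHanner d Q

/-- Threshold graphs: obtainable from the empty graph by repeatedly adding an isolated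
vertex or a dominating vertex (up to isomorphism of labelled graphs on `Fin n`). -/
inductive IsThresholdGraph : {n : ℕ} → SimpleGraph (Fin n) → Prop
  | empty : IsThresholdGraph (⊥ : SimpleGraph (Fin 0))
  | addIsolated {n : ℕ} {G : SimpleGraph (Fin n)} :
      IsThresholdGraph G → IsThresholdGraph (G.map Fin.castSuccEmb)
  | addDominating {n : ℕ} {G : SimpleGraph (Fin n)} :
      IsThresholdGraph G → IsThresholdGraph ((Gᶜ.map Fin.castSuccEmb)ᶜ)
  | iso {n : ℕ} {G G' : SimpleGraph (Fin n)} :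
      IsThresholdGraph G → (G ≃g G') → IsThresholdGraph G'

/-- The clique number of a graph, as an element of `ℕ∞`. -/
noncomputable def cliqueNumber {V : Type*} (G : SimpleGraph V) : ℕ∞ :=
  ⨆ t ∈ {t : Finset V | G.IsClique (↑t : Set V)}, (t.card : ℕ∞)

/-- A graph is perfect if for every induced subgraph the clique number equals
the chromatic number. -/
def IsPerfect {V : Type*} (G : SimpleGraph V) : Prop :=
  ∀ s : Set V, cliqueNumber (G.induce s) = (G.induce s).chromaticNumber

/-- Points `v₀, v` of `V` and `f₀, f` of `F` that are paired like the stable sets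
`∅, {a}, {b}, {c}, {d}, {a, c}, {b, d}` and the cliques `∅, {a}, {b}, {c}, {d}, {a, b}, {c, d}` of
an alternating 4-cycle `a, b, d, c` are paired in a Hansen polytope. -/
def HasAlternatingPattern {d : ℕ} (V F : Set (Fin d → ℝ)) : Prop :=
  ∃ (v₀ f₀ : Fin d → ℝ) (v f : Fin 4 → Fin d → ℝ),
    (v₀ ∈ V ∧ (∀ i, v i ∈ V) ∧ v 0 + v 2 - v₀ ∈ V ∧ v 1 + v 3 - v₀ ∈ V) ∧
    (f₀ ∈ F ∧ (∀ i, f i ∈ F) ∧ f 0 + f 1 - f₀ ∈ F ∧ f 2 + f 3 - f₀ ∈ F) ∧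
    f₀ ⬝ᵥ v₀ = 1 ∧ (∀ i, f i ⬝ᵥ v₀ = 1) ∧ (∀ i, f₀ ⬝ᵥ v i = 1) ∧
    ∀ i j, f i ⬝ᵥ v j = if i = j then -1 else 1

theorem HasAlternatingPattern.symm {d : ℕ} {V F : Set (Fin d → ℝ)}
    (h : HasAlternatingPattern V F) : HasAlternatingPattern F V := by
  obtain ⟨v₀, f₀, v, f, ⟨hv₀, hv, hv02, hv13⟩, ⟨hf₀, hf, hf01, hf23⟩, h1, h2, h3, h4⟩ := h
  have s0 : Equiv.swap (1 : Fin 4) 2 0 = 0 := by decide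
  have s1 : Equiv.swap (1 : Fin 4) 2 1 = 2 := by decide
  have s2 : Equiv.swap (1 : Fin 4) 2 2 = 1 := by decide
  have s3 : Equiv.swap (1 : Fin 4) 2 3 = 3 := by decide
  refine ⟨f₀, v₀, fun i => f (Equiv.swap 1 2 i), fun i => v (Equiv.swap 1 2 i),
    ⟨hf₀, fun i => hf _, ?_, ?_⟩, ⟨hv₀, fun i => hv _, ?_, ?_⟩, ?_, ?_, ?_, ?_⟩
  · simpa only [s0, s1, s2, s3] using hf01
  · simpa only [s0, s1, s2, s3] using hf23
  · simpa only [s0, s1, s2, s3] using hv02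
  · simpa only [s0, s1, s2, s3] using hv13
  · rw [dotProduct_comm, h1]
  · intro i; rw [dotProduct_comm, h3]
  · intro i; rw [dotProduct_comm, h2]
  · intro i j
    rw [dotProduct_comm, h4]
    simp [eq_comm]

theorem mem_polarDual {d : ℕ} {P : Set (Fin d → ℝ)} {y : Fin d → ℝ} :
    y ∈ polarDual P ↔ ∀ x ∈ P, y ⬝ᵥ x ≤ 1 := Iff.rfl

theorem zero_mem_polarDual {d : ℕ} (P : Set (Fin d → ℝ)) : 0 ∈ polarDual P := by
  simp [mem_polarDual]

theorem polarDual_eq_iInter {d : ℕ} (P : Set (Fin d → ℝ)) :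
    polarDual P = ⋂ x ∈ P, {y | y ⬝ᵥ x ≤ 1} := by
  ext y
  simp [mem_polarDual]

theorem convex_polarDual {d : ℕ} (P : Set (Fin d → ℝ)) : Convex ℝ (polarDual P) := by
  rw [polarDual_eq_iInter]
  refine convex_iInter₂ fun x _ => convex_halfSpace_le ⟨fun a b => ?_, fun c a => ?_⟩ 1
  · exact add_dotProduct a b x
  · exact smul_dotProduct c a x

theorem isClosed_polarDual {d : ℕ} (P : Set (Fin d → ℝ)) : IsClosed (polarDual P) := by
  rw [polarDual_eq_iInter]
  refine isClosed_biInter fun x _ => isClosed_le ?_ continuous_const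
  unfold dotProduct
  fun_prop

theorem polarDual_polarDual {d : ℕ} {P : Set (Fin d → ℝ)} (hc : Convex ℝ P) (hP : IsClosed P)
    (h0 : 0 ∈ P) : polarDual (polarDual P) = P := by
  refine Set.Subset.antisymm (fun x hx => ?_) fun x hx y hy => ?_
  · by_contra hxP
    obtain ⟨g, u, hgu, hux⟩ := geometric_hahn_banach_closed_point hc hP hxP
    have hu : 0 < u := by simpa using hgu 0 h0
    set y := (dotProductEquiv ℝ (Fin d)).symm (g : (Fin d → ℝ) →ₗ[ℝ] ℝ) with hy
    have hyg : ∀ z, y ⬝ᵥ z = g z := fun z => by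
      rw [← dotProductEquiv_apply_apply, hy, LinearEquiv.apply_symm_apply]
      rfl
    have hyP : u⁻¹ • y ∈ polarDual P := fun z hz => by
      change (u⁻¹ • y) ⬝ᵥ z ≤ 1
      rw [smul_dotProduct, hyg, smul_eq_mul, inv_mul_le_iff₀ hu, mul_one]
      exact (hgu z hz).le
    have h := mem_polarDual.1 hx _ hyP
    rw [dotProduct_comm, smul_dotProduct, hyg, smul_eq_mul, inv_mul_le_iff₀ hu, mul_one] at h
    exact absurd h (not_le.2 hux)
  · exact (dotProduct_comm x y).trans_le (hy x hx)

theorem polarDual_convexHull {d : ℕ} (s : Set (Fin d → ℝ)) :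
    polarDual (convexHull ℝ s) = polarDual s := by
  refine Set.Subset.antisymm (fun y hy x hx => hy x (subset_convexHull ℝ s hx)) fun y hy x hx => ?_
  exact convexHull_min (t := {x | y ⬝ᵥ x ≤ 1}) (fun z hz => hy z hz)
    (convex_halfSpace_le ⟨dotProduct_add y, fun c a => dotProduct_smul c y a⟩ 1) hx

theorem HasAlternatingPattern.image {d : ℕ} {P : Set (Fin d → ℝ)}
    (e : (Fin d → ℝ) ≃ₗ[ℝ] (Fin d → ℝ))
    (h : HasAlternatingPattern (P.extremePoints ℝ) ((polarDual P).extremePoints ℝ)) :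
    HasAlternatingPattern ((e '' P).extremePoints ℝ)
      ((polarDual (e '' P)).extremePoints ℝ) := by
  obtain ⟨v₀, f₀, v, f, ⟨hv₀, hv, hv02, hv13⟩, ⟨hf₀, hf, hf01, hf23⟩, h1, h2, h3, h4⟩ := h
  let e' : (Fin d → ℝ) ≃ₗ[ℝ] (Fin d → ℝ) :=
    (dotProductEquiv ℝ (Fin d)).trans (e.symm.dualMap.trans (dotProductEquiv ℝ (Fin d)).symm)
  have he' : ∀ y x, e' y ⬝ᵥ x = y ⬝ᵥ e.symm x := fun y x => by
    rw [← dotProductEquiv_apply_apply]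
    simp [e']
  have hpol : polarDual (e '' P) = e' '' polarDual P := by
    ext y
    obtain ⟨z, rfl⟩ := e'.surjective y
    rw [e'.injective.mem_set_image, mem_polarDual, mem_polarDual, Set.forall_mem_image]
    simp [he']
  rw [hpol, ← image_extremePoints, ← image_extremePoints]
  refine ⟨e v₀, e' f₀, fun i => e (v i), fun i => e' (f i),
    ⟨⟨_, hv₀, rfl⟩, fun i => ⟨_, hv i, rfl⟩, ⟨_, hv02, by simp⟩, ⟨_, hv13, by simp⟩⟩,
    ⟨⟨_, hf₀, rfl⟩, fun i => ⟨_, hf i, rfl⟩, ⟨_, hf01, by simp⟩, ⟨_, hf23, by simp⟩⟩,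
    ?_, ?_, ?_, ?_⟩ <;> simpa [he']

section ProductDecomposition

variable {d d₁ d₂ : ℕ} {P₁ : Set (Fin d₁ → ℝ)} {P₂ : Set (Fin d₂ → ℝ)}
  {L : (Fin d → ℝ) →ₗ[ℝ] (Fin d₁ → ℝ)} {R : (Fin d → ℝ) →ₗ[ℝ] (Fin d₂ → ℝ)}

/-- `L` and `R` identify `ℝ^d` with `ℝ^d₁ × ℝ^d₂`, compatibly with the scalar products. -/
structure IsOrthogonalSplitting (L : (Fin d → ℝ) →ₗ[ℝ] (Fin d₁ → ℝ))
    (R : (Fin d → ℝ) →ₗ[ℝ] (Fin d₂ → ℝ)) : Prop where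
  eq_of_eq : ∀ x y, L x = L y → R x = R y → x = y
  exists_lift : ∀ a b, ∃ x, L x = a ∧ R x = b
  dotProduct_eq : ∀ x y, x ⬝ᵥ y = L x ⬝ᵥ L y + R x ⬝ᵥ R y

theorem IsOrthogonalSplitting.symm (h : IsOrthogonalSplitting L R) :
    IsOrthogonalSplitting R L where
  eq_of_eq x y h₁ h₂ := h.eq_of_eq x y h₂ h₁
  exists_lift a b := (h.exists_lift b a).imp fun _ => And.symm
  dotProduct_eq x y := (h.dotProduct_eq x y).trans (add_comm _ _)

theorem isOrthogonalSplitting_fin (d₁ d₂ : ℕ) :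
    IsOrthogonalSplitting (LinearMap.funLeft ℝ ℝ (Fin.castAdd d₂ : Fin d₁ → _))
      (LinearMap.funLeft ℝ ℝ (Fin.natAdd d₁ : Fin d₂ → _)) where
  eq_of_eq x y h₁ h₂ := by
    ext i
    refine Fin.addCases (fun j => congrFun h₁ j) (fun j => congrFun h₂ j) i
  exists_lift a b := ⟨Fin.append a b, by ext; simp [LinearMap.funLeft_apply],
    by ext; simp [LinearMap.funLeft_apply]⟩
  dotProduct_eq x y := Fin.sum_univ_add _

theorem IsOrthogonalSplitting.eq_zero_or_eq_zero (h : IsOrthogonalSplitting L R) (h₁ : 0 ∈ P₁)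
    (h₂ : 0 ∈ P₂) {f : Fin d → ℝ}
    (hf : f ∈ (polarDual {x | L x ∈ P₁ ∧ R x ∈ P₂}).extremePoints ℝ) : L f = 0 ∨ R f = 0 := by
  by_contra! hne
  obtain ⟨hL, hR⟩ := hne
  rw [mem_extremePoints] at hf
  obtain ⟨hfP, hext⟩ := hf
  have hsum : ∀ x ∈ P₁, ∀ y ∈ P₂, L f ⬝ᵥ x + R f ⬝ᵥ y ≤ 1 := fun x hx y hy => by
    obtain ⟨z, rfl, rfl⟩ := h.exists_lift x y
    rw [← h.dotProduct_eq]
    exact hfP z ⟨hx, hy⟩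
  set S : Set ℝ := (fun x => L f ⬝ᵥ x) '' P₁ with hS
  have hbdd : BddAbove S := ⟨1, by
    rintro _ ⟨x, hx, rfl⟩
    simpa using hsum x hx 0 h₂⟩
  have h0S : (0 : ℝ) ∈ S := ⟨0, h₁, by simp⟩
  have hα0 : 0 ≤ sSup S := le_csSup hbdd h0S
  have hL1 : ∀ x ∈ P₁, L f ⬝ᵥ x ≤ sSup S := fun x hx => le_csSup hbdd ⟨x, hx, rfl⟩
  have hR1 : ∀ y ∈ P₂, R f ⬝ᵥ y ≤ 1 - sSup S := fun y hy => by
    have : sSup S ≤ 1 - R f ⬝ᵥ y := csSup_le ⟨0, h0S⟩ (by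
      rintro _ ⟨x, hx, rfl⟩
      have := hsum x hx y hy
      simp only
      linarith)
    linarith
  have hα1 : sSup S ≤ 1 := by simpa using hR1 0 h₂
  generalize sSup S = α at *
  -- It suffices to write `f` as a proper convex combination of two points of the polar.
  have key : ∀ s t a b a' b' : ℝ, 0 < s → 0 < t → s + t = 1 → s * a + t * a' = 1 →
      s * b + t * b' = 1 → (a ≠ 1 ∨ b ≠ 1) →
      (∀ x ∈ P₁, ∀ y ∈ P₂, a * (L f ⬝ᵥ x) + b * (R f ⬝ᵥ y) ≤ 1) →
      (∀ x ∈ P₁, ∀ y ∈ P₂, a' * (L f ⬝ᵥ x) + b' * (R f ⬝ᵥ y) ≤ 1) → False := by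
    intro s t a b a' b' hs ht hst ha hb hab hm hm'
    obtain ⟨z, hz₁, hz₂⟩ := h.exists_lift (a • L f) (b • R f)
    obtain ⟨z', hz'₁, hz'₂⟩ := h.exists_lift (a' • L f) (b' • R f)
    have hzf := (hext z (fun x hx => ?_) z' (fun x hx => ?_) ⟨s, t, hs, ht, hst, ?_⟩).1
    · subst hzf
      rcases hab with hab | hab
      · apply hL
        have : (1 - a) • L z = 0 := by rw [sub_smul, one_smul, ← hz₁, sub_self]
        exact (smul_eq_zero.1 this).resolve_left (sub_ne_zero.2 hab.symm)
      · apply hR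
        have : (1 - b) • R z = 0 := by rw [sub_smul, one_smul, ← hz₂, sub_self]
        exact (smul_eq_zero.1 this).resolve_left (sub_ne_zero.2 hab.symm)
    · change z ⬝ᵥ x ≤ 1
      rw [h.dotProduct_eq, hz₁, hz₂, smul_dotProduct, smul_dotProduct]
      exact hm _ hx.1 _ hx.2
    · change z' ⬝ᵥ x ≤ 1
      rw [h.dotProduct_eq, hz'₁, hz'₂, smul_dotProduct, smul_dotProduct]
      exact hm' _ hx.1 _ hx.2
    · apply h.eq_of_eq
      · rw [map_add, map_smul, map_smul, hz₁, hz'₁, smul_smul, smul_smul, ← add_smul, ha, one_smul]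
      · rw [map_add, map_smul, map_smul, hz₂, hz'₂, smul_smul, smul_smul, ← add_smul, hb, one_smul]
  rcases hα0.eq_or_lt with rfl | hα0
  · refine key (1 / 2) (1 / 2) 2 1 0 1 (by norm_num) (by norm_num) (by norm_num) (by norm_num)
      (by norm_num) (Or.inl (by norm_num)) (fun x hx y hy => ?_) (fun x hx y hy => ?_)
    · linarith [hL1 x hx, hR1 y hy]
    · linarith [hL1 x hx, hR1 y hy]
  rcases hα1.eq_or_lt with rfl | hα1
  · refine key (1 / 2) (1 / 2) 1 2 1 0 (by norm_num) (by norm_num) (by norm_num) (by norm_num)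
      (by norm_num) (Or.inr (by norm_num)) (fun x hx y hy => ?_) (fun x hx y hy => ?_)
    · linarith [hL1 x hx, hR1 y hy]
    · linarith [hL1 x hx, hR1 y hy]
  · have hβ : 0 < 1 - α := by linarith
    refine key α (1 - α) α⁻¹ 0 0 (1 - α)⁻¹ hα0 hβ (by ring) ?_ ?_
      (Or.inr (by norm_num)) (fun x hx y hy => ?_) (fun x hx y hy => ?_)
    · simp [hα0.ne']
    · simp [hβ.ne']
    · rw [zero_mul, add_zero, inv_mul_le_iff₀ hα0, mul_one]
      exact hL1 x hx
    · rw [zero_mul, zero_add, inv_mul_le_iff₀ hβ, mul_one]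
      exact hR1 y hy

theorem IsOrthogonalSplitting.map_mem_extremePoints (h : IsOrthogonalSplitting L R)
    {v : Fin d → ℝ} (hv : v ∈ {x | L x ∈ P₁ ∧ R x ∈ P₂}.extremePoints ℝ) :
    L v ∈ P₁.extremePoints ℝ := by
  rw [mem_extremePoints_iff_left] at hv ⊢
  refine ⟨hv.1.1, ?_⟩
  rintro a ha b hb ⟨s, t, hs, ht, hst, hab⟩
  obtain ⟨x, rfl, hx⟩ := h.exists_lift a (R v)
  obtain ⟨y, rfl, hy⟩ := h.exists_lift b (R v)
  have hR := hv.1.2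
  rw [hv.2 x ⟨ha, by rwa [hx]⟩ y ⟨hb, by rwa [hy]⟩ ⟨s, t, hs, ht, hst, h.eq_of_eq _ _ (by simpa) ?_⟩]
  rw [map_add, map_smul, map_smul, hx, hy, ← add_smul, hst, one_smul]

theorem IsOrthogonalSplitting.map_mem_extremePoints_polarDual (h : IsOrthogonalSplitting L R)
    (h₂ : 0 ∈ P₂) {f : Fin d → ℝ}
    (hf : f ∈ (polarDual {x | L x ∈ P₁ ∧ R x ∈ P₂}).extremePoints ℝ) (hfR : R f = 0) :
    L f ∈ (polarDual P₁).extremePoints ℝ := by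
  rw [mem_extremePoints_iff_left] at hf ⊢
  refine ⟨fun x hx => ?_, ?_⟩
  · obtain ⟨z, rfl, hz⟩ := h.exists_lift x 0
    have := mem_polarDual.1 hf.1 z ⟨hx, by rwa [hz]⟩
    rwa [h.dotProduct_eq, hfR, zero_dotProduct, add_zero] at this
  · rintro a ha b hb ⟨s, t, hs, ht, hst, hab⟩
    obtain ⟨x, rfl, hx⟩ := h.exists_lift a 0
    obtain ⟨y, rfl, hy⟩ := h.exists_lift b 0
    have hmem : ∀ w, L w ∈ polarDual P₁ → R w = 0 →
        w ∈ polarDual {x | L x ∈ P₁ ∧ R x ∈ P₂} := fun w hw hw' z hz => by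
      change w ⬝ᵥ z ≤ 1
      rw [h.dotProduct_eq, hw', zero_dotProduct, add_zero]
      exact hw _ hz.1
    rw [hf.2 x (hmem x ha hx) y (hmem y hb hy)
      ⟨s, t, hs, ht, hst, h.eq_of_eq _ _ (by simpa) (by simp [hx, hy, hfR])⟩]

/-- If `f₁`, `f₂` and `f₁ + f₂ - f₀` all lie in one of the two summands, then they lie in the same
summand as `f₀`. -/
theorem IsOrthogonalSplitting.eq_zero_of_parallelogram (h : IsOrthogonalSplitting L R)
    {f₀ f₁ f₂ : Fin d → ℝ} (h₀ : R f₀ = 0) (h₁ : L f₁ = 0 ∨ R f₁ = 0) (h₂ : L f₂ = 0 ∨ R f₂ = 0)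
    (h₁₂ : L (f₁ + f₂ - f₀) = 0 ∨ R (f₁ + f₂ - f₀) = 0) (hne₀ : f₀ ≠ 0) (hne₁ : f₁ ≠ f₀)
    (hne₂ : f₂ ≠ f₀) (hne : f₁ + f₂ ≠ 0) : R f₁ = 0 ∧ R f₂ = 0 := by
  by_cases hR₁ : R f₁ = 0 <;> by_cases hR₂ : R f₂ = 0
  · exact ⟨hR₁, hR₂⟩
  · have hL₂ := h₂.resolve_right hR₂
    have hL := h₁₂.resolve_right (by simpa [hR₁, h₀] using hR₂)
    simp only [map_sub, map_add, hL₂, add_zero, sub_eq_zero] at hL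
    exact absurd (h.eq_of_eq _ _ hL (hR₁.trans h₀.symm)) hne₁
  · have hL₁ := h₁.resolve_right hR₁
    have hL := h₁₂.resolve_right (by simpa [hR₂, h₀] using hR₁)
    simp only [map_sub, map_add, hL₁, zero_add, sub_eq_zero] at hL
    exact absurd (h.eq_of_eq _ _ hL (hR₂.trans h₀.symm)) hne₂
  · have hL₁ := h₁.resolve_right hR₁
    have hL₂ := h₂.resolve_right hR₂
    rcases h₁₂ with h₁₂ | h₁₂
    · simp only [map_sub, map_add, hL₁, hL₂, add_zero, zero_sub, neg_eq_zero] at h₁₂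
      exact absurd (h.eq_of_eq f₀ 0 (by simpa) (by simpa)) hne₀
    · simp only [map_sub, h₀, sub_zero] at h₁₂
      exact absurd (h.eq_of_eq (f₁ + f₂) 0 (by simp [hL₁, hL₂]) (by rwa [map_zero])) hne

theorem IsOrthogonalSplitting.not_hasAlternatingPattern (h : IsOrthogonalSplitting L R)
    (h₁ : 0 ∈ P₁) (h₂ : 0 ∈ P₂)
    (hP₁ : ¬ HasAlternatingPattern (P₁.extremePoints ℝ) ((polarDual P₁).extremePoints ℝ))
    (hP₂ : ¬ HasAlternatingPattern (P₂.extremePoints ℝ) ((polarDual P₂).extremePoints ℝ)) :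
    ¬ HasAlternatingPattern ({x | L x ∈ P₁ ∧ R x ∈ P₂}.extremePoints ℝ)
      ((polarDual {x | L x ∈ P₁ ∧ R x ∈ P₂}).extremePoints ℝ) := by
  rintro ⟨v₀, f₀, v, f, hV, hF, hp⟩
  -- By symmetry we may assume that `f₀` lies in the first summand.
  wlog hR₀ : R f₀ = 0 generalizing d₁ d₂
  · have hset : {x | L x ∈ P₁ ∧ R x ∈ P₂} = {x | R x ∈ P₂ ∧ L x ∈ P₁} := by
      ext; exact and_comm
    have hL₀ := (h.eq_zero_or_eq_zero h₁ h₂ hF.1).resolve_right hR₀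
    rw [hset] at hV hF
    exact this h.symm h₂ h₁ hP₂ hP₁ hV hF hL₀
  obtain ⟨hv₀, hv, hv02, hv13⟩ := hV
  obtain ⟨hf₀, hf, hf01, hf23⟩ := hF
  obtain ⟨p00, p0, p0', p⟩ := hp
  have hne₀ : f₀ ≠ 0 := by
    rintro rfl
    simp at p00
  have hne : ∀ i, f i ≠ f₀ := fun i hi => by
    have := p i i
    rw [hi, p0', if_pos rfl] at this
    norm_num at this
  have hne' : ∀ i j, f i + f j ≠ 0 := fun i j hij => by
    have := congrArg (· ⬝ᵥ v₀) hij
    simp only [add_dotProduct, p0, zero_dotProduct] at this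
    norm_num at this
  have hR01 := h.eq_zero_of_parallelogram hR₀ (h.eq_zero_or_eq_zero h₁ h₂ (hf 0))
    (h.eq_zero_or_eq_zero h₁ h₂ (hf 1)) (h.eq_zero_or_eq_zero h₁ h₂ hf01) hne₀ (hne 0) (hne 1)
    (hne' 0 1)
  have hR23 := h.eq_zero_of_parallelogram hR₀ (h.eq_zero_or_eq_zero h₁ h₂ (hf 2))
    (h.eq_zero_or_eq_zero h₁ h₂ (hf 3)) (h.eq_zero_or_eq_zero h₁ h₂ hf23) hne₀ (hne 2) (hne 3)
    (hne' 2 3)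
  have hR : ∀ i, R (f i) = 0 := by
    intro i
    fin_cases i
    exacts [hR01.1, hR01.2, hR23.1, hR23.2]
  have hdot : ∀ g, R g = 0 → ∀ x, L g ⬝ᵥ L x = g ⬝ᵥ x := fun g hg x => by
    rw [h.dotProduct_eq g x, hg, zero_dotProduct, add_zero]
  refine hP₁ ⟨L v₀, L f₀, fun i => L (v i), fun i => L (f i),
    ⟨h.map_mem_extremePoints hv₀, fun i => h.map_mem_extremePoints (hv i), ?_, ?_⟩,
    ⟨h.map_mem_extremePoints_polarDual h₂ hf₀ hR₀,
      fun i => h.map_mem_extremePoints_polarDual h₂ (hf i) (hR i), ?_, ?_⟩, ?_, ?_, ?_, ?_⟩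
  · simpa using h.map_mem_extremePoints hv02
  · simpa using h.map_mem_extremePoints hv13
  · simpa using h.map_mem_extremePoints_polarDual h₂ hf01 (by simp [hR, hR₀])
  · simpa using h.map_mem_extremePoints_polarDual h₂ hf23 (by simp [hR, hR₀])
  · rw [hdot _ hR₀, p00]
  · intro i; rw [hdot _ (hR i), p0]
  · intro i; rw [hdot _ hR₀, p0']
  · intro i j; rw [hdot _ (hR i), p]

end ProductDecomposition

theorem isClosed_and_convex_of_image {d : ℕ} {P Q : Set (Fin d → ℝ)}
    (e : (Fin d → ℝ) ≃ₗ[ℝ] (Fin d → ℝ)) (he : e '' P = Q) (hc : Convex ℝ Q) (hQ : IsClosed Q)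
    (h0 : 0 ∈ Q) : Convex ℝ P ∧ IsClosed P ∧ 0 ∈ P := by
  have hP : P = e ⁻¹' Q := by rw [← he, Set.preimage_image_eq _ e.injective]
  rw [hP]
  refine ⟨hc.linear_preimage e.toLinearMap,
    hQ.preimage (LinearMap.continuous_of_finiteDimensional e.toLinearMap), ?_⟩
  simpa using h0

theorem IsHanner.convex_isClosed {d : ℕ} {P : Set (Fin d → ℝ)} (h : IsHanner d P) :
    Convex ℝ P ∧ IsClosed P ∧ 0 ∈ P := by
  induction h with
  | segment v hv =>
    refine ⟨convex_segment _ _, ?_, 1 / 2, 1 / 2, by norm_num, by norm_num, by norm_num, by simp⟩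
    rw [← convexHull_pair]
    exact (Set.toFinite _).isClosed_convexHull ℝ
  | @prod d₁ d₂ P₁ P₂ _ _ P e he ih₁ ih₂ =>
    refine isClosed_and_convex_of_image e he ?_ ?_ ⟨ih₁.2.2, ih₂.2.2⟩
    · exact (ih₁.1.linear_preimage (LinearMap.funLeft ℝ ℝ (Fin.castAdd d₂))).inter
        (ih₂.1.linear_preimage (LinearMap.funLeft ℝ ℝ (Fin.natAdd d₁)))
    · exact (ih₁.2.1.preimage (by fun_prop)).inter (ih₂.2.1.preimage (by fun_prop))
  | polar _ Q e he _ =>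
    exact isClosed_and_convex_of_image e he (convex_polarDual _) (isClosed_polarDual _)
      (zero_mem_polarDual _)

theorem IsHanner.not_hasAlternatingPattern {d : ℕ} {P : Set (Fin d → ℝ)} (h : IsHanner d P) :
    ¬ HasAlternatingPattern (P.extremePoints ℝ) ((polarDual P).extremePoints ℝ) := by
  induction h with
  | segment v hv =>
    rintro ⟨v₀, f₀, v, f, -, -, p00, p0, p0', p⟩
    have h1 := p0 0
    have h2 := p 0 0
    have h3 := p0' 0
    simp only [dotProduct, Finset.univ_unique, Finset.sum_singleton, if_true] at p00 h1 h2 h3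
    have : (f 0 default * v₀ default) * (f₀ default * v 0 default) =
      (f 0 default * v 0 default) * (f₀ default * v₀ default) := by ring
    rw [p00, h1, h2, h3] at this
    norm_num at this
  | @prod d₁ d₂ P₁ P₂ h₁ h₂ P e he ih₁ ih₂ =>
    intro hP
    have := hP.image e
    rw [he] at this
    exact (isOrthogonalSplitting_fin d₁ d₂).not_hasAlternatingPattern h₁.convex_isClosed.2.2
      h₂.convex_isClosed.2.2 ih₁ ih₂ this
  | polar h Q e he ih =>
    intro hQ
    have := hQ.image e
    obtain ⟨hc, hcl, h0⟩ := h.convex_isClosed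
    rw [he, polarDual_polarDual hc hcl h0] at this
    exact ih this.symm

/-- The functional `x ↦ x₀ - 2 ∑_{i ∈ C} xᵢ`, which defines a facet of the Hansen polytope when `C`
is a clique. -/
def cliqueFunctional {n : ℕ} (C : Finset (Fin n)) : Fin (n + 1) → ℝ :=
  Fin.cons 1 fun i => if i ∈ C then -2 else 0

theorem hansenVert_eq_cons {n : ℕ} (I : Finset (Fin n)) :
    hansenVert I = Fin.cons 1 fun i => if i ∈ I then 1 else 0 := by
  ext j
  refine Fin.cases rfl (fun i => rfl) j

theorem cliqueFunctional_dotProduct_hansenVert {n : ℕ} (C I : Finset (Fin n)) :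
    cliqueFunctional C ⬝ᵥ hansenVert I = 1 - 2 * (C ∩ I).card := by
  simp only [cliqueFunctional, hansenVert_eq_cons, dotProduct, Fin.sum_univ_succ, Fin.cons_zero,
    Fin.cons_succ, mul_ite, mul_one, mul_zero, ← ite_and]
  rw [Finset.sum_ite, Finset.sum_const_zero, add_zero, Finset.sum_const, nsmul_eq_mul]
  have : Finset.univ.filter (fun i => i ∈ I ∧ i ∈ C) = C ∩ I := by ext; simp [and_comm]
  rw [this]
  ring

theorem cliqueFunctional_dotProduct_hansenVert_mem {n : ℕ} {G : SimpleGraph (Fin n)}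
    {C I : Finset (Fin n)} (hC : G.IsClique (C : Set (Fin n))) (hI : IsStable G I) :
    cliqueFunctional C ⬝ᵥ hansenVert I = 1 ∨ cliqueFunctional C ⬝ᵥ hansenVert I = -1 := by
  have hcard : (C ∩ I).card ≤ 1 := Finset.card_le_one.2 fun a ha b hb => by
    rw [Finset.mem_inter] at ha hb
    by_contra hab
    exact hI ha.2 hb.2 (hC ha.1 hb.1 hab)
  rw [cliqueFunctional_dotProduct_hansenVert]
  interval_cases (C ∩ I).card <;> norm_num

theorem hansenVert_mem {n : ℕ} {G : SimpleGraph (Fin n)} {I : Finset (Fin n)}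
    (hI : IsStable G I) : hansenVert I ∈ hansenPolytope G :=
  subset_convexHull ℝ _ ⟨I, hI, Or.inl rfl⟩

theorem neg_hansenVert_mem {n : ℕ} {G : SimpleGraph (Fin n)} {I : Finset (Fin n)}
    (hI : IsStable G I) : -hansenVert I ∈ hansenPolytope G :=
  subset_convexHull ℝ _ ⟨I, hI, Or.inr rfl⟩

theorem cliqueFunctional_mem {n : ℕ} {G : SimpleGraph (Fin n)} {C : Finset (Fin n)}
    (hC : G.IsClique (C : Set (Fin n))) :
    cliqueFunctional C ∈ polarDual (hansenPolytope G) ∧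
      -cliqueFunctional C ∈ polarDual (hansenPolytope G) := by
  rw [hansenPolytope, polarDual_convexHull, mem_polarDual, mem_polarDual]
  constructor <;> rintro _ ⟨I, hI, rfl | rfl⟩ <;>
    rcases cliqueFunctional_dotProduct_hansenVert_mem hC hI with h | h <;> simp [h]

theorem isStable_empty {n : ℕ} (G : SimpleGraph (Fin n)) : IsStable G ∅ := by
  simp [IsStable]

theorem isStable_singleton {n : ℕ} (G : SimpleGraph (Fin n)) (i : Fin n) : IsStable G {i} := by
  simp [IsStable]

theorem isStable_pair {n : ℕ} {G : SimpleGraph (Fin n)} {i j : Fin n} (h : ¬ G.Adj i j) :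
    IsStable G {i, j} := by
  simp [IsStable, h, mt SimpleGraph.Adj.symm h]

/-- If `f` attains its maximum `1` over `x`, `y` at a point between them, then it is `1` at `x`. -/
theorem dotProduct_eq_one_of_mem_openSegment {d : ℕ} {f x y z : Fin d → ℝ}
    (hz : z ∈ openSegment ℝ x y) (hx : f ⬝ᵥ x ≤ 1) (hy : f ⬝ᵥ y ≤ 1) (hfz : f ⬝ᵥ z = 1) :
    f ⬝ᵥ x = 1 := by
  obtain ⟨s, t, hs, ht, hst, rfl⟩ := hz
  rw [dotProduct_add, dotProduct_smul, dotProduct_smul, smul_eq_mul, smul_eq_mul] at hfz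
  nlinarith

theorem cliqueFunctional_empty_dotProduct {n : ℕ} (x : Fin (n + 1) → ℝ) :
    cliqueFunctional ∅ ⬝ᵥ x = x 0 := by
  simp [cliqueFunctional, dotProduct, Fin.sum_univ_succ]

theorem cliqueFunctional_singleton_dotProduct {n : ℕ} (x : Fin (n + 1) → ℝ) (i : Fin n) :
    cliqueFunctional {i} ⬝ᵥ x = x 0 - 2 * x i.succ := by
  simp [cliqueFunctional, dotProduct, Fin.sum_univ_succ]
  ring

theorem hansenVert_empty_dotProduct {n : ℕ} (x : Fin (n + 1) → ℝ) :
    hansenVert ∅ ⬝ᵥ x = x 0 := by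
  simp [hansenVert_eq_cons, dotProduct, Fin.sum_univ_succ]

theorem hansenVert_singleton_dotProduct {n : ℕ} (x : Fin (n + 1) → ℝ) (i : Fin n) :
    hansenVert {i} ⬝ᵥ x = x 0 + x i.succ := by
  simp [hansenVert_eq_cons, dotProduct, Fin.sum_univ_succ]

theorem hansenVert_mem_extremePoints {n : ℕ} {G : SimpleGraph (Fin n)} {I : Finset (Fin n)}
    (hI : IsStable G I) : hansenVert I ∈ (hansenPolytope G).extremePoints ℝ := by
  rw [mem_extremePoints_iff_left]
  refine ⟨hansenVert_mem hI, fun x hx y hy hxy => ?_⟩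
  have key : ∀ C : Finset (Fin n), G.IsClique (C : Set (Fin n)) →
      cliqueFunctional C ⬝ᵥ x = cliqueFunctional C ⬝ᵥ hansenVert I := fun C hC => by
    obtain ⟨hp, hm⟩ := cliqueFunctional_mem hC
    rcases cliqueFunctional_dotProduct_hansenVert_mem hC hI with h | h
    · rw [h]
      exact dotProduct_eq_one_of_mem_openSegment hxy (hp x hx) (hp y hy) h
    · rw [h, ← neg_eq_iff_eq_neg, ← neg_dotProduct]
      exact dotProduct_eq_one_of_mem_openSegment hxy (hm x hx) (hm y hy) (by simp [h])
  have h0 := key ∅ (by simp)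
  rw [cliqueFunctional_empty_dotProduct, cliqueFunctional_empty_dotProduct] at h0
  ext j
  refine Fin.cases h0 (fun i => ?_) j
  have hi := key {i} (by simp)
  rw [cliqueFunctional_singleton_dotProduct, cliqueFunctional_singleton_dotProduct] at hi
  linarith

theorem cliqueFunctional_mem_extremePoints {n : ℕ} {G : SimpleGraph (Fin n)} {C : Finset (Fin n)}
    (hC : G.IsClique (C : Set (Fin n))) :
    cliqueFunctional C ∈ (polarDual (hansenPolytope G)).extremePoints ℝ := by
  rw [mem_extremePoints_iff_left]
  refine ⟨(cliqueFunctional_mem hC).1, fun x hx y hy hxy => ?_⟩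
  have key : ∀ I : Finset (Fin n), IsStable G I →
      hansenVert I ⬝ᵥ x = hansenVert I ⬝ᵥ cliqueFunctional C := fun I hI => by
    have hp : ∀ z ∈ polarDual (hansenPolytope G), hansenVert I ⬝ᵥ z ≤ 1 := fun z hz =>
      (dotProduct_comm _ _).trans_le (hz _ (hansenVert_mem hI))
    have hm : ∀ z ∈ polarDual (hansenPolytope G), -hansenVert I ⬝ᵥ z ≤ 1 := fun z hz =>
      (dotProduct_comm _ _).trans_le (hz _ (neg_hansenVert_mem hI))
    rw [dotProduct_comm _ (cliqueFunctional C)]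
    rcases cliqueFunctional_dotProduct_hansenVert_mem hC hI with h | h
    · rw [h]
      exact dotProduct_eq_one_of_mem_openSegment hxy (hp x hx) (hp y hy)
        ((dotProduct_comm _ _).trans h)
    · rw [h, ← neg_eq_iff_eq_neg, ← neg_dotProduct]
      exact dotProduct_eq_one_of_mem_openSegment hxy (hm x hx) (hm y hy)
        (by rw [neg_dotProduct, dotProduct_comm, h, neg_neg])
  have h0 := key ∅ (isStable_empty G)
  rw [hansenVert_empty_dotProduct, hansenVert_empty_dotProduct] at h0
  ext j
  refine Fin.cases h0 (fun i => ?_) j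
  have hi := key {i} (isStable_singleton G i)
  rw [hansenVert_singleton_dotProduct, hansenVert_singleton_dotProduct] at hi
  linarith

theorem hansenVert_add_sub {n : ℕ} {i j : Fin n} (hij : i ≠ j) :
    hansenVert {i} + hansenVert {j} - hansenVert ∅ = hansenVert {i, j} := by
  ext k
  refine Fin.cases ?_ (fun l => ?_) k
  · simp [hansenVert_eq_cons]
  · simp only [hansenVert_eq_cons, Pi.sub_apply, Pi.add_apply, Fin.cons_succ, Finset.mem_singleton,
      Finset.notMem_empty, if_false, Finset.mem_insert, sub_zero]
    by_cases h1 : l = i <;> by_cases h2 : l = j <;> simp_all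

theorem cliqueFunctional_add_sub {n : ℕ} {i j : Fin n} (hij : i ≠ j) :
    cliqueFunctional {i} + cliqueFunctional {j} - cliqueFunctional ∅ =
      cliqueFunctional {i, j} := by
  ext k
  refine Fin.cases ?_ (fun l => ?_) k
  · simp [cliqueFunctional]
  · simp only [cliqueFunctional, Pi.sub_apply, Pi.add_apply, Fin.cons_succ, Finset.mem_singleton,
      Finset.notMem_empty, if_false, Finset.mem_insert, sub_zero]
    by_cases h1 : l = i <;> by_cases h2 : l = j <;> simp_all

/-- The graph contains two edges `ab`, `cd` and two non-edges `ac`, `bd`. -/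
def HasAlternatingCycle {V : Type*} (G : SimpleGraph V) : Prop :=
  ∃ a b c d, G.Adj a b ∧ G.Adj c d ∧ a ≠ c ∧ b ≠ d ∧ ¬ G.Adj a c ∧ ¬ G.Adj b d

theorem HasAlternatingCycle.hasAlternatingPattern {n : ℕ} {G : SimpleGraph (Fin n)}
    (h : HasAlternatingCycle G) :
    HasAlternatingPattern ((hansenPolytope G).extremePoints ℝ)
      ((polarDual (hansenPolytope G)).extremePoints ℝ) := by
  obtain ⟨a, b, c, d, hab, hcd, hac, hbd, hac', hbd'⟩ := h
  have had : a ≠ d := by rintro rfl; exact hac' hcd.symm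
  have hbc : b ≠ c := by rintro rfl; exact hac' hab
  have hinj : Function.Injective ![a, b, c, d] := by
    intro i j
    fin_cases i <;> fin_cases j <;>
      simp [hab.ne, hab.ne', hcd.ne, hcd.ne', hac, hac.symm, hbd, hbd.symm, had, had.symm, hbc,
        hbc.symm]
  refine ⟨hansenVert ∅, cliqueFunctional ∅, fun i => hansenVert {![a, b, c, d] i},
    fun i => cliqueFunctional {![a, b, c, d] i},
    ⟨hansenVert_mem_extremePoints (isStable_empty G),
      fun i => hansenVert_mem_extremePoints (isStable_singleton G _), ?_, ?_⟩,
    ⟨cliqueFunctional_mem_extremePoints (by simp),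
      fun i => cliqueFunctional_mem_extremePoints (by simp), ?_, ?_⟩, ?_, fun i => ?_, fun i => ?_,
    fun i j => ?_⟩
  · exact (hansenVert_add_sub hac).symm ▸ hansenVert_mem_extremePoints (isStable_pair hac')
  · exact (hansenVert_add_sub hbd).symm ▸ hansenVert_mem_extremePoints (isStable_pair hbd')
  · exact (cliqueFunctional_add_sub hab.ne).symm ▸
      cliqueFunctional_mem_extremePoints (by simp [hab])
  · exact (cliqueFunctional_add_sub hcd.ne).symm ▸
      cliqueFunctional_mem_extremePoints (by simp [hcd])
  · simp [cliqueFunctional_dotProduct_hansenVert]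
  · simp [cliqueFunctional_dotProduct_hansenVert]
  · simp [cliqueFunctional_dotProduct_hansenVert]
  · rw [cliqueFunctional_dotProduct_hansenVert]
    split_ifs with hij
    · subst hij
      norm_num
    · rw [Finset.singleton_inter_of_notMem (by simpa using hinj.ne hij)]
      simp

theorem IsHanner.not_hasAlternatingCycle {n : ℕ} {G : SimpleGraph (Fin n)}
    (h : IsHanner (n + 1) (hansenPolytope G)) : ¬ HasAlternatingCycle G :=
  fun hG => h.not_hasAlternatingPattern hG.hasAlternatingPattern

theorem HasAlternatingCycle.comap {V W : Type*} {G : SimpleGraph W} {f : V → W}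
    (hf : Function.Injective f) (h : HasAlternatingCycle (G.comap f)) :
    HasAlternatingCycle G := by
  obtain ⟨a, b, c, d, hab, hcd, hac, hbd, hac', hbd'⟩ := h
  exact ⟨f a, f b, f c, f d, hab, hcd, hf.ne hac, hf.ne hbd, hac', hbd'⟩

/-- A nonempty finite graph without alternating 4-cycles has an isolated or a dominating vertex:
a vertex of maximum degree is dominating unless there is an isolated vertex. -/
theorem exists_isolated_or_dominating {V : Type*} [Fintype V] [Nonempty V] {G : SimpleGraph V}
    (hG : ¬ HasAlternatingCycle G) :
    ∃ u, (∀ w, ¬ G.Adj u w) ∨ ∀ w, w ≠ u → G.Adj u w := by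
  classical
  by_contra! hcon
  obtain ⟨u, hu⟩ := Finite.exists_max fun v => G.degree v
  obtain ⟨w, hwu, huw⟩ := (hcon u).2
  obtain ⟨x, hwx⟩ := (hcon w).1
  have hnb : ∀ y, G.Adj u y → y ≠ x → G.Adj x y := fun y huy hyx => by
    by_contra hxy
    exact hG ⟨w, x, u, y, hwx, huy, hwu, hyx.symm, fun h => huw h.symm, hxy⟩
  have hlt : G.degree u < G.degree x := by
    by_cases hux : G.Adj u x
    · have hsub : insert u (insert w ((G.neighborFinset u).erase x)) ⊆ G.neighborFinset x := by
        intro y hy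
        simp only [Finset.mem_insert, Finset.mem_erase, SimpleGraph.mem_neighborFinset] at hy ⊢
        rcases hy with rfl | rfl | ⟨hyx, huy⟩
        exacts [hux.symm, hwx.symm, hnb y huy hyx]
      have hcard := Finset.card_le_card hsub
      rw [Finset.card_insert_of_notMem (by simp [hwu.symm]),
        Finset.card_insert_of_notMem (by simp [huw]),
        Finset.card_erase_of_mem (by simpa using hux), SimpleGraph.card_neighborFinset_eq_degree,
        SimpleGraph.card_neighborFinset_eq_degree] at hcard
      omega
    · have hsub : insert w (G.neighborFinset u) ⊆ G.neighborFinset x := by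
        intro y hy
        simp only [Finset.mem_insert, SimpleGraph.mem_neighborFinset] at hy ⊢
        rcases hy with rfl | huy
        exacts [hwx.symm, hnb y huy (by rintro rfl; exact hux huy)]
      have hcard := Finset.card_le_card hsub
      rw [Finset.card_insert_of_notMem (by simp [huw]), SimpleGraph.card_neighborFinset_eq_degree,
        SimpleGraph.card_neighborFinset_eq_degree] at hcard
      omega
  exact absurd (hu x) (not_le.2 hlt)

theorem eq_map_comap_castSucc {n : ℕ} {G : SimpleGraph (Fin (n + 1))}
    (h : ∀ w, ¬ G.Adj (Fin.last n) w) :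
    G = (G.comap Fin.castSucc).map Fin.castSuccEmb := by
  ext a b
  refine ⟨fun hab => ?_, ?_⟩
  · induction a using Fin.lastCases with
    | last => exact absurd hab (h b)
    | cast a =>
      induction b using Fin.lastCases with
      | last => exact absurd hab.symm (h _)
      | cast b => exact (SimpleGraph.map_adj _ _ _ _).2 ⟨a, b, hab, rfl, rfl⟩
  · rw [SimpleGraph.map_adj]
    rintro ⟨a, b, hab, rfl, rfl⟩
    exact hab

theorem isThresholdGraph_of_not_hasAlternatingCycle {n : ℕ} {G : SimpleGraph (Fin n)}
    (hG : ¬ HasAlternatingCycle G) : IsThresholdGraph G := by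
  induction n with
  | zero =>
    rw [Subsingleton.elim G ⊥]
    exact .empty
  | succ n ih =>
    obtain ⟨u, hu⟩ := exists_isolated_or_dominating hG
    set σ : Fin (n + 1) ≃ Fin (n + 1) := Equiv.swap u (Fin.last n) with hσ
    have hσl : σ (Fin.last n) = u := Equiv.swap_apply_right _ _
    refine IsThresholdGraph.iso (G := G.comap σ) ?_ (SimpleGraph.Iso.comap σ G)
    have hG' : ¬ HasAlternatingCycle (G.comap σ) := fun h => hG (h.comap σ.injective)
    have hG'' := ih (G := (G.comap σ).comap Fin.castSucc)
      fun h => hG' (h.comap (Fin.castSucc_injective n))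
    rcases hu with hu | hu
    · rw [eq_map_comap_castSucc (G := G.comap σ) fun w => by simpa [hσl] using hu (σ w)]
      exact hG''.addIsolated
    · have hc := eq_map_comap_castSucc (G := (G.comap σ)ᶜ) fun w => by
        rw [SimpleGraph.compl_adj, SimpleGraph.comap_adj, hσl, not_and, not_not]
        exact fun hw => hu _ fun h => hw (σ.injective (hσl.trans h.symm))
      have hcc : (G.comap σ)ᶜ.comap Fin.castSucc = ((G.comap σ).comap Fin.castSucc)ᶜ := by
        ext a b
        simp [SimpleGraph.compl_adj]
      rw [← compl_compl (G.comap σ), hc, hcc]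
      exact hG''.addDominating

theorem IsHanner.of_image_eq {d : ℕ} {P Q : Set (Fin d → ℝ)} (h : IsHanner d P)
    (e : (Fin d → ℝ) ≃ₗ[ℝ] (Fin d → ℝ)) (he : e '' Q = P) : IsHanner d Q := by
  obtain ⟨hc, hcl, h0⟩ := h.convex_isClosed
  refine (h.polar (polarDual P) (LinearEquiv.refl ℝ _) (Set.image_id _)).polar Q e ?_
  rw [he, polarDual_polarDual hc hcl h0]

/-- The points whose convex hull is the Hansen polytope of `G`. -/
def hansenPoints {n : ℕ} (G : SimpleGraph (Fin n)) : Set (Fin (n + 1) → ℝ) :=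
  {x | ∃ I : Finset (Fin n), IsStable G I ∧ (x = hansenVert I ∨ x = -hansenVert I)}

theorem hansenPolytope_eq {n : ℕ} (G : SimpleGraph (Fin n)) :
    hansenPolytope G = convexHull ℝ (hansenPoints G) := rfl

theorem finite_hansenPoints {n : ℕ} (G : SimpleGraph (Fin n)) : (hansenPoints G).Finite := by
  refine ((Set.finite_range hansenVert).union
    (Set.finite_range fun I => -hansenVert (n := n) I)).subset ?_
  rintro _ ⟨I, -, rfl | rfl⟩
  exacts [Or.inl ⟨I, rfl⟩, Or.inr ⟨I, rfl⟩]

theorem isClosed_hansenPolytope {n : ℕ} (G : SimpleGraph (Fin n)) :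
    IsClosed (hansenPolytope G) :=
  (finite_hansenPoints G).isClosed_convexHull ℝ

theorem zero_mem_hansenPolytope {n : ℕ} (G : SimpleGraph (Fin n)) : 0 ∈ hansenPolytope G :=
  (convex_convexHull ℝ _).segment_subset (hansenVert_mem (isStable_empty G))
    (neg_hansenVert_mem (isStable_empty G))
    ⟨1 / 2, 1 / 2, by norm_num, by norm_num, by norm_num, by simp⟩

theorem image_hansenPolytope {n m : ℕ} (G : SimpleGraph (Fin n))
    (e : (Fin (n + 1) → ℝ) ≃ₗ[ℝ] (Fin m → ℝ)) :
    e '' hansenPolytope G = convexHull ℝ (e '' hansenPoints G) :=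
  LinearMap.image_convexHull e.toLinearMap _

theorem IsHanner.hansenPolytope_iso {n : ℕ} {G G' : SimpleGraph (Fin n)}
    (h : IsHanner (n + 1) (hansenPolytope G)) (φ : G ≃g G') :
    IsHanner (n + 1) (hansenPolytope G') := by
  let e : (Fin (n + 1) → ℝ) ≃ₗ[ℝ] (Fin (n + 1) → ℝ) := LinearEquiv.funCongrLeft ℝ ℝ
    ((finSuccEquiv n).trans ((Equiv.optionCongr φ.toEquiv).trans (finSuccEquiv n).symm))
  have he : ∀ I, e (hansenVert I) = hansenVert (I.map φ.symm.toEquiv.toEmbedding) := fun I => by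
    ext j
    refine Fin.cases ?_ (fun i => ?_) j
    · simp [e, hansenVert_eq_cons, LinearEquiv.funCongrLeft_apply, LinearMap.funLeft_apply]
    · simp only [e, hansenVert_eq_cons, LinearEquiv.funCongrLeft_apply, LinearMap.funLeft_apply,
        Fin.cons_succ, Finset.mem_map_equiv]
      simp
      rfl
  have hst : ∀ {H K : SimpleGraph (Fin n)} (ψ : H ≃g K) {I : Finset (Fin n)}, IsStable H I →
      IsStable K (I.map ψ.toEquiv.toEmbedding) := fun ψ I hI a ha b hb hab => by
    rw [Finset.mem_map_equiv] at ha hb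
    exact hI ha hb ((ψ.symm.map_adj_iff).2 hab)
  refine h.of_image_eq e ?_
  rw [image_hansenPolytope, hansenPolytope_eq]
  congr 1
  refine Set.Subset.antisymm ?_ ?_
  · rintro _ ⟨_, ⟨I, hI, rfl | rfl⟩, rfl⟩
    · exact ⟨_, hst φ.symm hI, Or.inl (he I)⟩
    · exact ⟨_, hst φ.symm hI, Or.inr (by rw [map_neg, he])⟩
  · rintro _ ⟨I, hI, hx⟩
    have heI : e (hansenVert (I.map φ.toEquiv.toEmbedding)) = hansenVert I := by
      rw [he]
      congr 1
      ext i
      simp only [Finset.mem_map_equiv]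
      exact iff_of_eq (congrArg (· ∈ I) (φ.symm_apply_apply i))
    rcases hx with rfl | rfl
    · exact ⟨_, ⟨_, hst φ hI, Or.inl rfl⟩, heI⟩
    · exact ⟨_, ⟨_, hst φ hI, Or.inr rfl⟩, by rw [map_neg, heI]⟩

/-- The trace on the first `n` vertices of a set of vertices. -/
def restrictLast {n : ℕ} (I : Finset (Fin (n + 1))) : Finset (Fin n) :=
  Finset.univ.filter fun i => i.castSucc ∈ I

theorem mem_restrictLast {n : ℕ} {I : Finset (Fin (n + 1))} {i : Fin n} :
    i ∈ restrictLast I ↔ i.castSucc ∈ I := by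
  simp [restrictLast]

theorem exists_restrictLast_eq {n : ℕ} (J : Finset (Fin n)) (p : Prop) :
    ∃ I : Finset (Fin (n + 1)), restrictLast I = J ∧ (Fin.last n ∈ I ↔ p) := by
  classical
  refine ⟨Finset.univ.filter fun i => Fin.lastCases (motive := fun _ => Prop) p (· ∈ J) i, ?_, ?_⟩
  · ext i
    simp [mem_restrictLast]
  · simp

theorem hansenVert_castSucc {n : ℕ} (I : Finset (Fin (n + 1))) (j : Fin (n + 1)) :
    hansenVert I j.castSucc = hansenVert (restrictLast I) j := by
  refine Fin.cases ?_ (fun i => ?_) j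
  · simp [hansenVert_eq_cons]
  · rw [← Fin.succ_castSucc]
    simp [hansenVert_eq_cons, mem_restrictLast]

theorem hansenVert_last {n : ℕ} (I : Finset (Fin (n + 1))) :
    hansenVert I (Fin.last (n + 1)) = if Fin.last n ∈ I then 1 else 0 := by
  rw [← Fin.succ_last, hansenVert_eq_cons, Fin.cons_succ]

theorem hansenVert_zero {n : ℕ} (I : Finset (Fin n)) : hansenVert I 0 = 1 := rfl

theorem map_castSuccEmb_adj {n : ℕ} {G : SimpleGraph (Fin n)} {a b : Fin n} :
    (G.map Fin.castSuccEmb).Adj a.castSucc b.castSucc ↔ G.Adj a b :=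
  SimpleGraph.map_adj_apply (f := Fin.castSuccEmb)

theorem not_map_castSuccEmb_adj_last {n : ℕ} {G : SimpleGraph (Fin n)} {a : Fin (n + 1)} :
    ¬ (G.map Fin.castSuccEmb).Adj (Fin.last n) a := by
  rw [SimpleGraph.map_adj]
  rintro ⟨a, b, -, h, -⟩
  exact (Fin.castSucc_lt_last a).ne h

theorem isStable_map_castSuccEmb {n : ℕ} {G : SimpleGraph (Fin n)} {I : Finset (Fin (n + 1))} :
    IsStable (G.map Fin.castSuccEmb) I ↔ IsStable G (restrictLast I) := by
  refine ⟨fun h a ha b hb hab => ?_, fun h a ha b hb hab => ?_⟩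
  · exact h (mem_restrictLast.1 ha) (mem_restrictLast.1 hb) (map_castSuccEmb_adj.2 hab)
  · induction a using Fin.lastCases with
    | last => exact not_map_castSuccEmb_adj_last hab
    | cast a =>
      induction b using Fin.lastCases with
      | last => exact not_map_castSuccEmb_adj_last hab.symm
      | cast b =>
        exact h (mem_restrictLast.2 ha) (mem_restrictLast.2 hb) (map_castSuccEmb_adj.1 hab)

theorem isStable_compl_map_castSuccEmb {n : ℕ} {G : SimpleGraph (Fin n)}
    {I : Finset (Fin (n + 1))} :
    IsStable (Gᶜ.map Fin.castSuccEmb)ᶜ I ↔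
      IsStable G (restrictLast I) ∧ (Fin.last n ∈ I → restrictLast I = ∅) := by
  have hadj : ∀ a b : Fin n, (Gᶜ.map Fin.castSuccEmb)ᶜ.Adj a.castSucc b.castSucc ↔ G.Adj a b := by
    intro a b
    rw [SimpleGraph.compl_adj, map_castSuccEmb_adj, SimpleGraph.compl_adj, Ne,
      Fin.castSucc_inj]
    have := G.ne_of_adj (a := a) (b := b)
    tauto
  have hlast : ∀ a : Fin n, (Gᶜ.map Fin.castSuccEmb)ᶜ.Adj (Fin.last n) a.castSucc := fun a =>
    ⟨(Fin.castSucc_lt_last a).ne', not_map_castSuccEmb_adj_last⟩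
  refine ⟨fun h => ⟨fun a ha b hb hab => ?_, fun hl => ?_⟩, fun h a ha b hb hab => ?_⟩
  · exact h (mem_restrictLast.1 ha) (mem_restrictLast.1 hb) ((hadj a b).2 hab)
  · exact Finset.eq_empty_of_forall_notMem fun a ha => h hl (mem_restrictLast.1 ha) (hlast a)
  · have hno : ∀ a : Fin n, Fin.last n ∈ I → a.castSucc ∉ I := fun a hl ha => by
      have := mem_restrictLast.2 ha
      rw [h.2 hl] at this
      simp at this
    induction a using Fin.lastCases with
    | last =>
      induction b using Fin.lastCases with
      | last => exact hab.ne rfl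
      | cast b => exact hno b ha hb
    | cast a =>
      induction b using Fin.lastCases with
      | last => exact hno a hb ha
      | cast b => exact h.1 (mem_restrictLast.2 ha) (mem_restrictLast.2 hb) ((hadj a b).1 hab)

theorem IsOrthogonalSplitting.convexHull_eq {d d₁ d₂ : ℕ}
    {L : (Fin d → ℝ) →ₗ[ℝ] (Fin d₁ → ℝ)} {R : (Fin d → ℝ) →ₗ[ℝ] (Fin d₂ → ℝ)}
    (h : IsOrthogonalSplitting L R) (s : Set (Fin d₁ → ℝ)) (t : Set (Fin d₂ → ℝ)) :
    convexHull ℝ {x | L x ∈ s ∧ R x ∈ t} = {x | L x ∈ convexHull ℝ s ∧ R x ∈ convexHull ℝ t} := by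
  let Φ : (Fin d → ℝ) ≃ₗ[ℝ] (Fin d₁ → ℝ) × (Fin d₂ → ℝ) := LinearEquiv.ofBijective (L.prod R)
    ⟨fun x y hxy => h.eq_of_eq x y (congrArg Prod.fst hxy) (congrArg Prod.snd hxy),
      fun ⟨a, b⟩ => (h.exists_lift a b).imp fun x hx => Prod.ext hx.1 hx.2⟩
  have hpre : ∀ (u : Set (Fin d₁ → ℝ)) (w : Set (Fin d₂ → ℝ)),
      {x | L x ∈ u ∧ R x ∈ w} = Φ.symm '' (u ×ˢ w) := fun u w => by
    ext x
    obtain ⟨y, rfl⟩ := Φ.symm.surjective x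
    rw [Φ.symm.injective.mem_set_image, Set.mem_prod, Set.mem_ofPred_eq,
      show y = Φ (Φ.symm y) from (Φ.apply_symm_apply y).symm]
    simp only [LinearEquiv.symm_apply_apply]
    rfl
  rw [hpre, hpre, ← convexHull_prod]
  exact (LinearMap.image_convexHull Φ.symm.toLinearMap _).symm

theorem mem_segment_neg_one_one {x : Fin 1 → ℝ} :
    x ∈ segment ℝ (-1 : Fin 1 → ℝ) 1 ↔ -1 ≤ x 0 ∧ x 0 ≤ 1 := by
  constructor
  · rintro ⟨s, t, hs, ht, hst, rfl⟩
    simp only [smul_neg, Pi.add_apply, Pi.neg_apply, Pi.smul_apply, Pi.one_apply, smul_eq_mul,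
      mul_one]
    constructor <;> linarith
  · rintro ⟨h₁, h₂⟩
    refine ⟨(1 - x 0) / 2, (1 + x 0) / 2, by linarith, by linarith, by ring, ?_⟩
    ext i
    rw [Subsingleton.elim i 0]
    simp only [smul_neg, Pi.add_apply, Pi.neg_apply, Pi.smul_apply, Pi.one_apply, smul_eq_mul,
      mul_one]
    ring

/-- The shear `(x₀, …, xₘ) ↦ (x₀, …, xₘ₋₁, 2 xₘ - x₀)`. -/
noncomputable def lastShear (m : ℕ) : (Fin (m + 1 + 1) → ℝ) ≃ₗ[ℝ] (Fin (m + 1 + 1) → ℝ) where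
  toFun x := Fin.snoc (fun j => x j.castSucc) (2 * x (Fin.last _) - x 0)
  invFun x := Fin.snoc (fun j => x j.castSucc) ((x (Fin.last _) + x 0) / 2)
  map_add' x y := by
    ext j
    refine Fin.lastCases ?_ (fun i => ?_) j
    · simp only [Fin.snoc_last, Pi.add_apply]; ring
    · simp only [Fin.snoc_castSucc, Pi.add_apply]
  map_smul' c x := by
    ext j
    refine Fin.lastCases ?_ (fun i => ?_) j
    · simp only [Fin.snoc_last, Pi.smul_apply, smul_eq_mul, RingHom.id_apply]; ring
    · simp only [Fin.snoc_castSucc, Pi.smul_apply, RingHom.id_apply]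
  left_inv x := by
    ext j
    refine Fin.lastCases ?_ (fun i => ?_) j
    · rw [← Fin.castSucc_zero]; simp only [Fin.snoc_last, Fin.snoc_castSucc]; ring
    · simp only [Fin.snoc_castSucc]
  right_inv x := by
    ext j
    refine Fin.lastCases ?_ (fun i => ?_) j
    · rw [← Fin.castSucc_zero]; simp only [Fin.snoc_last, Fin.snoc_castSucc]; ring
    · simp only [Fin.snoc_castSucc]

theorem lastShear_castSucc {m : ℕ} (x : Fin (m + 1 + 1) → ℝ) (j : Fin (m + 1)) :
    lastShear m x j.castSucc = x j.castSucc := by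
  simp [lastShear]

theorem lastShear_last {m : ℕ} (x : Fin (m + 1 + 1) → ℝ) :
    lastShear m x (Fin.last _) = 2 * x (Fin.last _) - x 0 := by
  simp [lastShear]

/-- The shear `(x₀, …, xₘ) ↦ (x₀ - xₘ, x₁, …, xₘ)`. -/
def zeroShear (m : ℕ) : (Fin (m + 1 + 1) → ℝ) ≃ₗ[ℝ] (Fin (m + 1 + 1) → ℝ) where
  toFun x := Fin.cons (x 0 - x (Fin.last _)) fun j => x j.succ
  invFun x := Fin.cons (x 0 + x (Fin.last _)) fun j => x j.succ
  map_add' x y := by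
    ext j
    refine Fin.cases ?_ (fun i => ?_) j
    · simp only [Fin.cons_zero, Pi.add_apply]; ring
    · simp only [Fin.cons_succ, Pi.add_apply]
  map_smul' c x := by
    ext j
    refine Fin.cases ?_ (fun i => ?_) j
    · simp only [Fin.cons_zero, Pi.smul_apply, smul_eq_mul, RingHom.id_apply]; ring
    · simp only [Fin.cons_succ, Pi.smul_apply, RingHom.id_apply]
  left_inv x := by
    ext j
    refine Fin.cases ?_ (fun i => ?_) j
    · rw [← Fin.succ_last]; simp only [Fin.cons_zero, Fin.cons_succ]; ring
    · simp only [Fin.cons_succ]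
  right_inv x := by
    ext j
    refine Fin.cases ?_ (fun i => ?_) j
    · rw [← Fin.succ_last]; simp only [Fin.cons_zero, Fin.cons_succ]; ring
    · simp only [Fin.cons_succ]

theorem zeroShear_zero {m : ℕ} (x : Fin (m + 1 + 1) → ℝ) :
    zeroShear m x 0 = x 0 - x (Fin.last _) := rfl

theorem zeroShear_succ {m : ℕ} (x : Fin (m + 1 + 1) → ℝ) (j : Fin (m + 1)) :
    zeroShear m x j.succ = x j.succ := rfl

theorem isHanner_segment_one : IsHanner 1 (segment ℝ (-1 : Fin 1 → ℝ) 1) :=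
  .segment 1 one_ne_zero

/-- Adding an isolated vertex multiplies the Hansen polytope by a segment. -/
theorem IsHanner.hansenPolytope_addIsolated {n : ℕ} {G : SimpleGraph (Fin n)}
    (h : IsHanner (n + 1) (hansenPolytope G)) :
    IsHanner (n + 1 + 1) (hansenPolytope (G.map Fin.castSuccEmb)) := by
  refine h.prod isHanner_segment_one _ (lastShear n) ?_
  have hsplit := isOrthogonalSplitting_fin (n + 1) 1
  rw [image_hansenPolytope, hansenPolytope_eq, ← convexHull_pair]
  refine Eq.trans ?_ (hsplit.convexHull_eq _ _)
  congr 1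
  have hvert : ∀ I : Finset (Fin (n + 1)),
      LinearMap.funLeft ℝ ℝ (Fin.castAdd 1) (lastShear n (hansenVert I)) =
          hansenVert (restrictLast I) ∧
        LinearMap.funLeft ℝ ℝ (Fin.natAdd (n + 1)) (lastShear n (hansenVert I)) =
          if Fin.last n ∈ I then (1 : Fin 1 → ℝ) else -1 := fun I => by
    constructor
    · ext j
      exact (lastShear_castSucc _ j).trans (hansenVert_castSucc I j)
    · ext j
      rw [Subsingleton.elim j 0]
      refine (lastShear_last _).trans ?_
      rw [hansenVert_last, hansenVert_zero]
      split_ifs <;> norm_num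
  refine Set.Subset.antisymm ?_ ?_
  · rintro _ ⟨_, ⟨I, hI, rfl | rfl⟩, rfl⟩
    · refine ⟨⟨_, isStable_map_castSuccEmb.1 hI, Or.inl (hvert I).1⟩, ?_⟩
      rw [(hvert I).2]
      split_ifs <;> simp
    · rw [map_neg]
      refine ⟨⟨_, isStable_map_castSuccEmb.1 hI, Or.inr (by rw [map_neg, (hvert I).1])⟩, ?_⟩
      rw [map_neg, (hvert I).2]
      split_ifs <;> simp
  · have key : ∀ J, IsStable G J → ∀ p : Prop, ∃ I, IsStable (G.map Fin.castSuccEmb) I ∧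
        restrictLast I = J ∧ (Fin.last n ∈ I ↔ p) := fun J hJ p => by
      obtain ⟨I, rfl, hI⟩ := exists_restrictLast_eq J p
      exact ⟨I, isStable_map_castSuccEmb.2 hJ, rfl, hI⟩
    rintro z ⟨⟨J, hJ, hz | hz⟩, hz' | hz'⟩
    · obtain ⟨I, hI, rfl, hl⟩ := key J hJ False
      exact ⟨_, ⟨I, hI, Or.inl rfl⟩, hsplit.eq_of_eq _ _ ((hvert I).1.trans hz.symm)
        ((hvert I).2.trans (by simp [hl, hz']))⟩
    · obtain ⟨I, hI, rfl, hl⟩ := key J hJ True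
      exact ⟨_, ⟨I, hI, Or.inl rfl⟩, hsplit.eq_of_eq _ _ ((hvert I).1.trans hz.symm)
        ((hvert I).2.trans (by simp [hl, Set.mem_singleton_iff.1 hz']))⟩
    · obtain ⟨I, hI, rfl, hl⟩ := key J hJ True
      refine ⟨_, ⟨I, hI, Or.inr rfl⟩, hsplit.eq_of_eq _ _ ?_ ?_⟩
      · rw [map_neg, map_neg, (hvert I).1, hz]
      · rw [map_neg, map_neg, (hvert I).2, hz', if_pos (hl.2 trivial)]
    · obtain ⟨I, hI, rfl, hl⟩ := key J hJ False
      refine ⟨_, ⟨I, hI, Or.inr rfl⟩, hsplit.eq_of_eq _ _ ?_ ?_⟩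
      · rw [map_neg, map_neg, (hvert I).1, hz]
      · rw [map_neg, map_neg, (hvert I).2, hz'.out, if_neg fun hh => hl.1 hh, neg_neg]

/-- Adding a dominating vertex multiplies the polar of the Hansen polytope by a segment. -/
theorem IsHanner.hansenPolytope_addDominating {n : ℕ} {G : SimpleGraph (Fin n)}
    (h : IsHanner (n + 1) (hansenPolytope G)) :
    IsHanner (n + 1 + 1) (hansenPolytope (Gᶜ.map Fin.castSuccEmb)ᶜ) := by
  set G' := (Gᶜ.map Fin.castSuccEmb)ᶜ with hG'
  have hpol : IsHanner (n + 1) (polarDual (hansenPolytope G)) :=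
    h.polar _ (LinearEquiv.refl ℝ _) (Set.image_id _)
  refine (hpol.prod isHanner_segment_one _ (LinearEquiv.refl ℝ _) (Set.image_id _)).polar _
    (zeroShear n) ?_
  rw [← polarDual_polarDual (P := zeroShear n '' hansenPolytope G')]
  rotate_left
  · exact (convex_convexHull ℝ _).linear_image (zeroShear n).toLinearMap
  · rw [image_hansenPolytope]
    exact ((finite_hansenPoints _).image _).isClosed_convexHull ℝ
  · exact ⟨0, zero_mem_hansenPolytope _, map_zero _⟩
  rw [image_hansenPolytope, polarDual_convexHull, hansenPolytope_eq G, polarDual_convexHull]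
  congr 1
  have hvert : ∀ (y : Fin (n + 1 + 1) → ℝ) (I : Finset (Fin (n + 1))),
      (Fin.last n ∈ I → restrictLast I = ∅) → y ⬝ᵥ zeroShear n (hansenVert I) =
        if Fin.last n ∈ I then y (Fin.last _)
          else (fun j : Fin (n + 1) => y j.castSucc) ⬝ᵥ hansenVert (restrictLast I) := by
    intro y I hI
    have hlast : zeroShear n (hansenVert I) (Fin.last _) = if Fin.last n ∈ I then 1 else 0 := by
      rw [← Fin.succ_last, zeroShear_succ, Fin.succ_last, hansenVert_last]
    have hcast : ∀ j : Fin (n + 1), zeroShear n (hansenVert I) j.castSucc =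
        if Fin.last n ∈ I then 0 else hansenVert (restrictLast I) j := fun j => by
      refine Fin.cases ?_ (fun i => ?_) j
      · rw [Fin.castSucc_zero, zeroShear_zero, hansenVert_last, hansenVert_zero, hansenVert_zero]
        split_ifs <;> norm_num
      · rw [← Fin.succ_castSucc, zeroShear_succ, Fin.succ_castSucc, hansenVert_castSucc]
        split_ifs with hl
        · rw [hI hl, hansenVert_eq_cons, Fin.cons_succ, if_neg (Finset.notMem_empty i)]
        · rfl
    simp only [dotProduct, Fin.sum_univ_castSucc (n := n + 1), hlast, hcast]
    split_ifs <;> simp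
  ext y
  rw [mem_polarDual, Set.forall_mem_image]
  refine ⟨fun hy => ⟨?_, mem_segment_neg_one_one.2 ?_⟩, ?_⟩
  · rintro _ ⟨J, hJ, hx⟩
    obtain ⟨I, rfl, hl⟩ := exists_restrictLast_eq J False
    have hI : IsStable G' I := isStable_compl_map_castSuccEmb.2 ⟨hJ, fun h' => (hl.1 h').elim⟩
    have hyI := hvert y I fun h' => (hl.1 h').elim
    rw [if_neg fun h' => hl.1 h'] at hyI
    change (fun j : Fin (n + 1) => y j.castSucc) ⬝ᵥ _ ≤ 1
    rcases hx with rfl | rfl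
    · exact hyI ▸ hy ⟨I, hI, Or.inl rfl⟩
    · have := hy ⟨I, hI, Or.inr rfl⟩
      rwa [map_neg, dotProduct_neg, hyI, ← dotProduct_neg] at this
  · obtain ⟨I, hI₀, hl⟩ := exists_restrictLast_eq (∅ : Finset (Fin n)) True
    have hI : IsStable G' I :=
      isStable_compl_map_castSuccEmb.2 ⟨hI₀ ▸ isStable_empty G, fun _ => hI₀⟩
    have hyI := hvert y I fun _ => hI₀
    rw [if_pos (hl.2 trivial)] at hyI
    have h₁ := hy ⟨I, hI, Or.inl rfl⟩
    have h₂ := hy ⟨I, hI, Or.inr rfl⟩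
    rw [map_neg, dotProduct_neg, hyI] at h₂
    rw [hyI] at h₁
    exact ⟨neg_le.1 h₂, h₁⟩
  · rintro ⟨hy, hy'⟩ x ⟨I, hI, hx⟩
    obtain ⟨hJ, hI₀⟩ := isStable_compl_map_castSuccEmb.1 hI
    obtain ⟨h₁, h₂⟩ := mem_segment_neg_one_one.1 hy'
    rcases hx with rfl | rfl
    · rw [hvert y I hI₀]
      split_ifs
      · exact h₂
      · exact hy _ ⟨_, hJ, Or.inl rfl⟩
    · rw [map_neg, dotProduct_neg, hvert y I hI₀]
      split_ifs
      · exact neg_le.1 h₁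
      · rw [← dotProduct_neg]
        exact hy _ ⟨_, hJ, Or.inr rfl⟩

theorem IsThresholdGraph.isHanner {n : ℕ} {G : SimpleGraph (Fin n)} (h : IsThresholdGraph G) :
    IsHanner (n + 1) (hansenPolytope G) := by
  induction h with
  | empty =>
    have h1 : hansenVert (∅ : Finset (Fin 0)) = 1 := by
      ext j
      exact congrArg (hansenVert ∅) (Subsingleton.elim (α := Fin 1) j 0)
    have : hansenPolytope (⊥ : SimpleGraph (Fin 0)) = segment ℝ (-1 : Fin 1 → ℝ) 1 := by
      rw [hansenPolytope_eq, ← convexHull_pair]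
      congr 1
      ext x
      refine ⟨?_, fun hx => ⟨∅, isStable_empty _, ?_⟩⟩
      · rintro ⟨I, -, hx⟩
        rw [Finset.eq_empty_of_isEmpty I, h1] at hx
        exact hx.symm
      · rw [h1]
        exact Or.symm hx
    rw [this]
    exact isHanner_segment_one
  | addIsolated _ ih => exact ih.hansenPolytope_addIsolated
  | addDominating _ ih => exact ih.hansenPolytope_addDominating
  | iso _ φ ih => exact ih.hansenPolytope_iso φ

/-- For a perfect graph `G`, the Hansen polytope `H(G)` is a Hanner polytope if and only
if `G` is a threshold graph. -/
theorem hansen_hanner_iff_threshold {n : ℕ} (G : SimpleGraph (Fin n)) (hG : IsPerfect G) :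
    IsHanner (n + 1) (hansenPolytope G) ↔ IsThresholdGraph G :=
  ⟨fun h => isThresholdGraph_of_not_hasAlternatingCycle h.not_hasAlternatingCycle,
    fun h => h.isHanner⟩
end

section
/- Let G be a split graph on d−1 vertices with vertex partition into a clique C and a stable set S. Then the number of nonempty faces of the Hansen polytope H(G) ⊆ ℝ^d satisfies s(H(G)) = 3^d + p_G(C,S). -/
/-- The number of nonempty (exposed) faces of a polytope `P ⊆ ℝ^d`, including `P` itself. -/
noncomputable def numFaces {d : ℕ} (P : Set (Fin d → ℝ)) : ℕ :=
  {F : Set (Fin d → ℝ) | IsExposed ℝ P F ∧ F.Nonempty}.ncard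

/-- `p_G(C,S)`: the number of partitions `(C⁺, C⁻, C⁰, S⁺, S⁻, S⁰)` of `(C, S)` —
encoded as quadruples `(C⁺, C⁻, S⁺, S⁻)` of disjoint subsets, with `C⁰, S⁰` the
complements — that are nontrivial (`C⁺ ∪ C⁻ ≠ ∅` or `S⁺ ∪ S⁻ ≠ ∅`) and satisfy
(A) every element of `C⁺ ∪ C⁻` has a neighbor in `S⁺ ∪ S⁻`, and
(B) every element of `S⁺ ∪ S⁻` has a non-neighbor in `C⁺ ∪ C⁻`. -/
noncomputable def pG {n : ℕ} (G : SimpleGraph (Fin n)) (C S : Finset (Fin n)) : ℕ :=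
  Set.ncard {q : Finset (Fin n) × Finset (Fin n) × Finset (Fin n) × Finset (Fin n) |
    q.1 ⊆ C ∧ q.2.1 ⊆ C ∧ Disjoint q.1 q.2.1 ∧
    q.2.2.1 ⊆ S ∧ q.2.2.2 ⊆ S ∧ Disjoint q.2.2.1 q.2.2.2 ∧
    ((q.1 ∪ q.2.1).Nonempty ∨ (q.2.2.1 ∪ q.2.2.2).Nonempty) ∧
    (∀ c ∈ q.1 ∪ q.2.1, ∃ s ∈ q.2.2.1 ∪ q.2.2.2, G.Adj c s) ∧
    (∀ s ∈ q.2.2.1 ∪ q.2.2.2, ∃ c ∈ q.1 ∪ q.2.1, ¬ G.Adj c s)}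

namespace HansenSplit

open Finset

variable {n : ℕ} (G : SimpleGraph (Fin n)) (C S : Finset (Fin n))

/-- `s` has no neighbor in `K`. -/
def NbrFree (K : Finset (Fin n)) (s : Fin n) : Prop := ∀ c ∈ K, ¬ G.Adj c s

open Classical in
/-- The maximum of `a₀ + ∑_{i ∈ I} a i` over the stable sets `I` with `I ∩ C = K`. -/
noncomputable def top (a₀ : ℝ) (a : Fin n → ℝ) (K : Finset (Fin n)) : ℝ :=
  a₀ + ∑ c ∈ K, a c + ∑ s ∈ S with NbrFree G K s, max (a s) 0

/-- Away from the neighbors of `I ∩ C`, the set `I ∩ S` contains the positive and avoids the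
negative places of `a`. -/
def Tight {R : Type*} [Zero R] [LT R] (a : Fin n → R) (I : Finset (Fin n)) : Prop :=
  ∀ s ∈ S, NbrFree G (I ∩ C) s → (0 < a s → s ∈ I) ∧ (a s < 0 → s ∉ I)

variable {G C S}

lemma inter_eq_empty_or_singleton (hC : G.IsClique (↑C : Set (Fin n))) {I : Finset (Fin n)}
    (hI : IsStable G I) : I ∩ C = ∅ ∨ ∃ c ∈ C, I ∩ C = {c} := by
  rcases (I ∩ C).eq_empty_or_nonempty with h | ⟨c, hc⟩
  · exact Or.inl h
  · refine Or.inr ⟨c, (mem_inter.1 hc).2, eq_singleton_iff_unique_mem.2 ⟨hc, fun d hd => ?_⟩⟩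
    rw [mem_inter] at hc hd
    by_contra hne
    exact hI hd.1 hc.1 (hC hd.2 hc.2 hne)

open Classical in
lemma sum_eq_of_isStable (hdisj : Disjoint C S) (hcover : C ∪ S = univ) {I : Finset (Fin n)}
    (hI : IsStable G I) (a : Fin n → ℝ) :
    ∑ i ∈ I, a i = ∑ c ∈ I ∩ C, a c +
      ∑ s ∈ S with NbrFree G (I ∩ C) s, if s ∈ I then a s else 0 := by
  have h1 : I = I ∩ C ∪ I ∩ S := by rw [← inter_union_distrib_left, hcover, inter_univ]
  have h2 : Disjoint (I ∩ C) (I ∩ S) :=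
    hdisj.mono inter_subset_right inter_subset_right
  conv_lhs => rw [h1, sum_union h2]
  congr 1
  rw [← sum_filter, filter_filter]
  refine sum_congr ?_ fun _ _ => rfl
  ext s
  simp only [mem_inter, mem_filter, NbrFree]
  constructor
  · rintro ⟨h, h'⟩
    exact ⟨h', fun c hc => hI hc.1 h, h⟩
  · rintro ⟨h, -, h'⟩
    exact ⟨h', h⟩

lemma sum_le_top (hdisj : Disjoint C S) (hcover : C ∪ S = univ) {I : Finset (Fin n)}
    (hI : IsStable G I) (a₀ : ℝ) (a : Fin n → ℝ) :
    a₀ + ∑ i ∈ I, a i ≤ top G S a₀ a (I ∩ C) := by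
  classical
  rw [sum_eq_of_isStable hdisj hcover hI a, top, ← add_assoc]
  gcongr with s
  split_ifs <;> simp

lemma sum_eq_top_iff (hdisj : Disjoint C S) (hcover : C ∪ S = univ) {I : Finset (Fin n)}
    (hI : IsStable G I) (a₀ : ℝ) (a : Fin n → ℝ) :
    a₀ + ∑ i ∈ I, a i = top G S a₀ a (I ∩ C) ↔ Tight G C S a I := by
  classical
  rw [sum_eq_of_isStable hdisj hcover hI a, top, ← add_assoc, add_right_inj,
    sum_eq_sum_iff_of_le fun s _ => by split_ifs <;> simp]
  simp only [mem_filter, and_imp, Tight]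
  refine forall₃_congr fun s _ _ => ?_
  split_ifs with h <;> simp [h]

lemma sum_eq_iff (hdisj : Disjoint C S) (hcover : C ∪ S = univ) {I : Finset (Fin n)}
    (hI : IsStable G I) {a₀ : ℝ} {a : Fin n → ℝ} {m : ℝ} (hm : top G S a₀ a (I ∩ C) ≤ m) :
    a₀ + ∑ i ∈ I, a i = m ↔ top G S a₀ a (I ∩ C) = m ∧ Tight G C S a I := by
  rw [← sum_eq_top_iff hdisj hcover hI a₀ a]
  have := sum_le_top hdisj hcover hI a₀ a
  constructor
  · intro h
    constructor <;> linarith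
  · rintro ⟨h, h'⟩
    linarith

/-- The stable set consisting of `K` and all vertices of `S` satisfying `p` without neighbors
in `K`. -/
noncomputable def fill (G : SimpleGraph (Fin n)) (S K : Finset (Fin n)) (p : Fin n → Prop) :
    Finset (Fin n) := by
  classical exact K ∪ {s ∈ S | NbrFree G K s ∧ p s}

lemma mem_fill {K : Finset (Fin n)} {p : Fin n → Prop} {i : Fin n} :
    i ∈ fill G S K p ↔ i ∈ K ∨ i ∈ S ∧ NbrFree G K i ∧ p i := by
  simp [fill]

lemma fill_inter (hdisj : Disjoint C S) {K : Finset (Fin n)} (hK : K ⊆ C) (p : Fin n → Prop) :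
    fill G S K p ∩ C = K := by
  ext i
  rw [mem_inter, mem_fill]
  constructor
  · rintro ⟨h | h, h'⟩
    · exact h
    · exact absurd h.1 (disjoint_left.1 hdisj h')
  · exact fun h => ⟨Or.inl h, hK h⟩

lemma isStable_fill (hS : IsStable G S) {K : Finset (Fin n)}
    (hK : K = ∅ ∨ ∃ c, K = {c}) (p : Fin n → Prop) : IsStable G (fill G S K p) := by
  intro x hx y hy hxy
  rw [mem_fill] at hx hy
  rcases hx with hx | ⟨hx, hx', -⟩ <;> rcases hy with hy | ⟨hy, hy', -⟩
  · rcases hK with rfl | ⟨c, rfl⟩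
    · simp at hx
    · rw [mem_singleton] at hx hy
      exact hxy.ne (hx.trans hy.symm)
  · exact hy' x hx hxy
  · exact hx' y hy hxy.symm
  · exact hS hx hy hxy

lemma tight_fill {R : Type*} [Zero R] [Preorder R] (hdisj : Disjoint C S) {K : Finset (Fin n)}
    (hK : K ⊆ C) {a : Fin n → R} {p : Fin n → Prop} (hp : ∀ s, 0 < a s → p s)
    (hn : ∀ s, a s < 0 → ¬ p s) : Tight G C S a (fill G S K p) := by
  intro s hs hf
  rw [fill_inter hdisj hK] at hf
  rw [mem_fill]
  refine ⟨fun h => Or.inr ⟨hs, hf, hp s h⟩, ?_⟩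
  rintro h (h' | h')
  · exact disjoint_left.1 hdisj (hK h') hs
  · exact hn s h h'.2.2

open Classical in
lemma top_add_top_neg (a₀ : ℝ) (a : Fin n → ℝ) (K : Finset (Fin n)) :
    top G S a₀ a K + top G S (-a₀) (-a) K = ∑ s ∈ S with NbrFree G K s, |a s| := by
  simp only [← max_zero_add_max_neg_zero_eq_abs_self, sum_add_distrib, top, Pi.neg_apply,
    sum_neg_distrib]
  ring

open Classical in
lemma top_empty_add_top_neg (a₀ : ℝ) (a : Fin n → ℝ) :
    top G S a₀ a ∅ + top G S (-a₀) (-a) ∅ = ∑ s ∈ S, |a s| := by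
  rw [top_add_top_neg, filter_true_of_mem]
  simp [NbrFree]

open Classical in
lemma top_singleton_add_top_neg (a₀ : ℝ) (a : Fin n → ℝ) (c : Fin n) :
    top G S a₀ a {c} + top G S (-a₀) (-a) {c} + ∑ s ∈ S with G.Adj c s, |a s| =
      ∑ s ∈ S, |a s| := by
  rw [top_add_top_neg, ← sum_filter_not_add_sum_filter S (fun s => G.Adj c s)]
  simp [NbrFree]

variable (G C S)

/-- The points `±(e₀ + ∑_{i ∈ I} e_i)` satisfy `l x ≤ m` for the functional `l` with
coefficients `a₀, a`. -/
structure Admissible (a₀ : ℝ) (a : Fin n → ℝ) (m : ℝ) : Prop where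
  empty : top G S a₀ a ∅ ≤ m
  empty_neg : top G S (-a₀) (-a) ∅ ≤ m
  single : ∀ c ∈ C, top G S a₀ a {c} ≤ m
  single_neg : ∀ c ∈ C, top G S (-a₀) (-a) {c} ≤ m

/-- Some point `±(e₀ + ∑_{i ∈ I} e_i)` attains the bound `m`. -/
def Attained (a₀ : ℝ) (a : Fin n → ℝ) (m : ℝ) : Prop :=
  top G S a₀ a ∅ = m ∨ top G S (-a₀) (-a) ∅ = m ∨
    ∃ c ∈ C, top G S a₀ a {c} = m ∨ top G S (-a₀) (-a) {c} = m

variable {G C S}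

namespace Admissible

variable {a₀ : ℝ} {a : Fin n → ℝ} {m : ℝ}

lemma neg (h : Admissible G C S a₀ a m) : Admissible G C S (-a₀) (-a) m where
  empty := h.empty_neg
  empty_neg := by simpa using h.empty
  single := h.single_neg
  single_neg := by simpa using h.single

lemma top_inter_le (h : Admissible G C S a₀ a m) (hC : G.IsClique (↑C : Set (Fin n)))
    {I : Finset (Fin n)} (hI : IsStable G I) : top G S a₀ a (I ∩ C) ≤ m := by
  rcases inter_eq_empty_or_singleton hC hI with h' | ⟨c, hc, h'⟩
  · rw [h']; exact h.empty
  · rw [h']; exact h.single c hc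

lemma eq_of_both (h : Admissible G C S a₀ a m) {c : Fin n}
    (h₁ : top G S a₀ a {c} = m) (h₂ : top G S (-a₀) (-a) {c} = m) :
    top G S a₀ a ∅ = m ∧ top G S (-a₀) (-a) ∅ = m ∧ ∀ s ∈ S, G.Adj c s → a s = 0 := by
  classical
  have e₁ := top_empty_add_top_neg (G := G) (S := S) a₀ a
  have e₂ := top_singleton_add_top_neg (G := G) (S := S) a₀ a c
  have h₃ := h.empty
  have h₄ := h.empty_neg
  have h₅ : 0 ≤ ∑ s ∈ S with G.Adj c s, |a s| := sum_nonneg fun _ _ => abs_nonneg _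
  refine ⟨by linarith, by linarith, fun s hs hcs => ?_⟩
  have h₆ : ∑ s ∈ S with G.Adj c s, |a s| = 0 := by linarith
  rw [sum_eq_zero_iff_of_nonneg fun _ _ => abs_nonneg _] at h₆
  exact abs_eq_zero.1 (h₆ s (mem_filter.2 ⟨hs, hcs⟩))

lemma both_of_eq {c : Fin n} (h : Admissible G C S a₀ a m) (hc : c ∈ C)
    (h₁ : top G S a₀ a ∅ = m) (h₂ : top G S (-a₀) (-a) ∅ = m)
    (hz : ∀ s ∈ S, G.Adj c s → a s = 0) :
    top G S a₀ a {c} = m ∧ top G S (-a₀) (-a) {c} = m := by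
  classical
  have e₁ := top_empty_add_top_neg (G := G) (S := S) a₀ a
  have e₂ := top_singleton_add_top_neg (G := G) (S := S) a₀ a c
  have h₃ := h.single c hc
  have h₄ := h.single_neg c hc
  have h₅ : ∑ s ∈ S with G.Adj c s, |a s| = 0 :=
    sum_eq_zero fun s hs => by rw [hz s (mem_filter.1 hs).1 (mem_filter.1 hs).2, abs_zero]
  constructor <;> linarith

end Admissible

variable (G C S)

/-- Whether a face with data `(u, v, ρ)` contains points `e₀ + ∑_{i ∈ I} e_i` with `c ∈ I`. -/
def Touches (u v : Bool) (ρ : Fin n → SignType) (c : Fin n) : Prop :=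
  ρ c = 1 ∨ u = true ∧ v = true ∧ ρ c = 0 ∧ ∀ s ∈ S, G.Adj c s → ρ s = 0

/-- The stable sets `I` with `e₀ + ∑_{i ∈ I} e_i` in the face with data `(u, v, ρ)`. -/
def halfFace (u v : Bool) (ρ : Fin n → SignType) : Set (Finset (Fin n)) :=
  {I | IsStable G I ∧ (I ∩ C = ∅ → u = true) ∧ (∀ c ∈ I ∩ C, Touches G S u v ρ c) ∧
    Tight G C S ρ I}

/-- The vertices of the face with data `(u, v, ρ)`. -/
def face (g : Bool × Bool × (Fin n → SignType)) : Set (Finset (Fin n)) × Set (Finset (Fin n)) :=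
  (halfFace G C S g.1 g.2.1 g.2.2, halfFace G C S g.2.1 g.1 (-g.2.2))

/-- Every element of `C` in the support of `ρ` has a neighbor in `S` in the support of `ρ`. -/
def NbrCond (ρ : Fin n → SignType) : Prop := ∀ c ∈ C, ρ c ≠ 0 → ∃ s ∈ S, ρ s ≠ 0 ∧ G.Adj c s

/-- The support of `ρ` meets `C`, and every element of `S` in the support of `ρ` has a non-neighbor
in `C` in the support of `ρ`. -/
def NonNbrCond (ρ : Fin n → SignType) : Prop :=
  (∃ c ∈ C, ρ c ≠ 0) ∧ ∀ s ∈ S, ρ s ≠ 0 → ∃ c ∈ C, ρ c ≠ 0 ∧ ¬ G.Adj c s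

/-- The data `(u, v, ρ)` that describe faces. -/
def Good (g : Bool × Bool × (Fin n → SignType)) : Prop :=
  (g.1 = true → g.2.1 = true → NbrCond G C S g.2.2) ∧
    (g.1 = false → g.2.1 = false → NonNbrCond G C S g.2.2)

open Classical in
/-- The sign vector describing the face where the functional with coefficients `a₀, a` takes its
maximum `m`. -/
noncomputable def signs (a₀ : ℝ) (a : Fin n → ℝ) (m : ℝ) (i : Fin n) : SignType :=
  if i ∈ C then
    if top G S a₀ a {i} = m ∧ top G S (-a₀) (-a) {i} ≠ m then 1
    else if top G S (-a₀) (-a) {i} = m ∧ top G S a₀ a {i} ≠ m then -1 else 0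
  else if top G S a₀ a ∅ = m ∨ top G S (-a₀) (-a) ∅ = m ∨
      ∃ c ∈ C, (top G S a₀ a {c} = m ∨ top G S (-a₀) (-a) {c} = m) ∧ ¬ G.Adj c i then
    SignType.sign (a i)
  else 0

open Classical in
/-- The data of the face where the functional with coefficients `a₀, a` takes its maximum `m`. -/
noncomputable def faceData (a₀ : ℝ) (a : Fin n → ℝ) (m : ℝ) :
    Bool × Bool × (Fin n → SignType) :=
  (decide (top G S a₀ a ∅ = m), decide (top G S (-a₀) (-a) ∅ = m), signs G C S a₀ a m)

variable {G C S}

lemma signs_neg (a₀ : ℝ) (a : Fin n → ℝ) (m : ℝ) :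
    signs G C S (-a₀) (-a) m = -signs G C S a₀ a m := by
  classical
  ext1 i
  simp only [signs, neg_neg, Pi.neg_apply, Left.sign_neg]
  by_cases hi : i ∈ C
  · simp only [hi, if_true]
    by_cases h₁ : top G S a₀ a {i} = m <;> by_cases h₂ : top G S (-a₀) (-a) {i} = m <;>
      simp [h₁, h₂]
  · simp only [hi, if_false]
    have : (top G S (-a₀) (-a) ∅ = m ∨ top G S a₀ a ∅ = m ∨
        ∃ c ∈ C, (top G S (-a₀) (-a) {c} = m ∨ top G S a₀ a {c} = m) ∧ ¬ G.Adj c i) ↔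
        (top G S a₀ a ∅ = m ∨ top G S (-a₀) (-a) ∅ = m ∨
        ∃ c ∈ C, (top G S a₀ a {c} = m ∨ top G S (-a₀) (-a) {c} = m) ∧ ¬ G.Adj c i) := by
      simp only [or_comm (a := top G S (-a₀) (-a) {_} = m)]
      exact or_left_comm
    rw [if_congr this rfl rfl]
    split_ifs <;> simp

lemma signs_of_visible (hdisj : Disjoint C S) {a₀ : ℝ} {a : Fin n → ℝ} {m : ℝ} {s : Fin n}
    (hs : s ∈ S) (h : top G S a₀ a ∅ = m ∨ top G S (-a₀) (-a) ∅ = m ∨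
      ∃ c ∈ C, (top G S a₀ a {c} = m ∨ top G S (-a₀) (-a) {c} = m) ∧ ¬ G.Adj c s) :
    signs G C S a₀ a m s = SignType.sign (a s) := by
  rw [signs, if_neg (disjoint_right.1 hdisj hs), if_pos h]

lemma signs_eq_one_iff {a₀ : ℝ} {a : Fin n → ℝ} {m : ℝ} {c : Fin n} (hc : c ∈ C) :
    signs G C S a₀ a m c = 1 ↔ top G S a₀ a {c} = m ∧ top G S (-a₀) (-a) {c} ≠ m := by
  rw [signs, if_pos hc]
  split_ifs <;> simp_all

lemma signs_eq_neg_one_iff {a₀ : ℝ} {a : Fin n → ℝ} {m : ℝ} {c : Fin n} (hc : c ∈ C) :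
    signs G C S a₀ a m c = -1 ↔ top G S (-a₀) (-a) {c} = m ∧ top G S a₀ a {c} ≠ m := by
  rw [signs, if_pos hc]
  split_ifs <;> simp_all

lemma signs_eq_zero_iff {a₀ : ℝ} {a : Fin n → ℝ} {m : ℝ} {c : Fin n} (hc : c ∈ C) :
    signs G C S a₀ a m c = 0 ↔ (top G S a₀ a {c} = m ↔ top G S (-a₀) (-a) {c} = m) := by
  rw [signs, if_pos hc]
  split_ifs <;> simp_all; tauto

lemma Admissible.touches_iff {a₀ : ℝ} {a : Fin n → ℝ} {m : ℝ} (h : Admissible G C S a₀ a m)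
    (hdisj : Disjoint C S) {c : Fin n} (hc : c ∈ C) :
    Touches G S (faceData G C S a₀ a m).1 (faceData G C S a₀ a m).2.1
      (faceData G C S a₀ a m).2.2 c ↔ top G S a₀ a {c} = m := by
  simp only [Touches, faceData, decide_eq_true_eq, signs_eq_one_iff hc, signs_eq_zero_iff hc]
  constructor
  · rintro (h' | ⟨h₁, h₂, -, h₃⟩)
    · exact h'.1
    · refine (h.both_of_eq hc h₁ h₂ fun s hs hcs => ?_).1
      have := h₃ s hs hcs
      rwa [signs_of_visible hdisj hs (Or.inl h₁), sign_eq_zero_iff] at this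
  · intro h₁
    by_cases h₂ : top G S (-a₀) (-a) {c} = m
    · obtain ⟨h₃, h₄, h₅⟩ := h.eq_of_both h₁ h₂
      refine Or.inr ⟨h₃, h₄, by simp [h₁, h₂], fun s hs hcs => ?_⟩
      rw [signs_of_visible hdisj hs (Or.inl h₃), h₅ s hs hcs, sign_zero]
    · exact Or.inl ⟨h₁, h₂⟩

lemma Admissible.halfFace_eq {a₀ : ℝ} {a : Fin n → ℝ} {m : ℝ} (h : Admissible G C S a₀ a m)
    (hdisj : Disjoint C S) (hcover : C ∪ S = univ) (hC : G.IsClique (↑C : Set (Fin n))) :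
    halfFace G C S (faceData G C S a₀ a m).1 (faceData G C S a₀ a m).2.1
      (faceData G C S a₀ a m).2.2 = {I | IsStable G I ∧ a₀ + ∑ i ∈ I, a i = m} := by
  ext I
  refine and_congr_right fun hI => ?_
  rw [sum_eq_iff hdisj hcover hI (h.top_inter_le hC hI), ← and_assoc]
  have h₁ : (I ∩ C = ∅ → (faceData G C S a₀ a m).1 = true) ∧
      (∀ c ∈ I ∩ C, Touches G S (faceData G C S a₀ a m).1 (faceData G C S a₀ a m).2.1
        (faceData G C S a₀ a m).2.2 c) ↔ top G S a₀ a (I ∩ C) = m := by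
    rcases inter_eq_empty_or_singleton hC hI with h' | ⟨c, hc, h'⟩
    · simp [h', faceData]
    · simp [h', h.touches_iff hdisj hc]
  rw [h₁]
  refine and_congr_right fun h₂ => ?_
  refine forall₃_congr fun s hs hf => ?_
  have : signs G C S a₀ a m s = SignType.sign (a s) := by
    refine signs_of_visible hdisj hs ?_
    rcases inter_eq_empty_or_singleton hC hI with h' | ⟨c, hc, h'⟩
    · exact Or.inl (h' ▸ h₂)
    · refine Or.inr (Or.inr ⟨c, hc, Or.inl (h' ▸ h₂), hf c (by simp [h'])⟩)
  simp [faceData, this, sign_eq_one_iff, sign_eq_neg_one_iff]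

lemma Admissible.face_eq {a₀ : ℝ} {a : Fin n → ℝ} {m : ℝ} (h : Admissible G C S a₀ a m)
    (hdisj : Disjoint C S) (hcover : C ∪ S = univ) (hC : G.IsClique (↑C : Set (Fin n))) :
    face G C S (faceData G C S a₀ a m) = ({I | IsStable G I ∧ a₀ + ∑ i ∈ I, a i = m},
      {I | IsStable G I ∧ -(a₀ + ∑ i ∈ I, a i) = m}) := by
  refine Prod.ext (h.halfFace_eq hdisj hcover hC) ?_
  have h₁ := h.neg.halfFace_eq hdisj hcover hC
  simp only [faceData, signs_neg, neg_neg, Pi.neg_apply, sum_neg_distrib, ← neg_add] at h₁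
  exact h₁

lemma Admissible.good {a₀ : ℝ} {a : Fin n → ℝ} {m : ℝ} (h : Admissible G C S a₀ a m)
    (hdisj : Disjoint C S) (hm : Attained G C S a₀ a m) :
    Good G C S (faceData G C S a₀ a m) := by
  classical
  simp only [Good, faceData, decide_eq_true_eq, decide_eq_false_iff_not]
  constructor
  · intro h₁ h₂ c hc hρ
    by_contra! hs
    refine hρ ((signs_eq_zero_iff hc).2 ?_)
    have := h.both_of_eq hc h₁ h₂ fun s hs' hcs => by
      by_contra h₃
      refine hs s hs' ?_ hcs
      rwa [signs_of_visible hdisj hs' (Or.inl h₁), Ne, sign_eq_zero_iff]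
    simp [this.1, this.2]
  · intro h₁ h₂
    have key : ∀ c ∈ C, (top G S a₀ a {c} = m ∨ top G S (-a₀) (-a) {c} = m) →
        signs G C S a₀ a m c ≠ 0 := by
      intro c hc h₃ h₄
      rw [signs_eq_zero_iff hc] at h₄
      exact h₁ (h.eq_of_both (c := c) (by tauto) (by tauto)).1
    constructor
    · rcases hm with h₃ | h₃ | ⟨c, hc, h₃⟩
      · exact absurd h₃ h₁
      · exact absurd h₃ h₂
      · exact ⟨c, hc, key c hc h₃⟩
    · intro s hs hρ
      rw [signs, if_neg (disjoint_right.1 hdisj hs)] at hρ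
      split_ifs at hρ with h₃
      · rcases h₃ with h₃ | h₃ | ⟨c, hc, h₃, h₄⟩
        · exact absurd h₃ h₁
        · exact absurd h₃ h₂
        · exact ⟨c, hc, key c hc h₃, h₄⟩
      · simp at hρ

lemma exists_faceData_eq (hdisj : Disjoint C S) (hcover : C ∪ S = univ)
    {g : Bool × Bool × (Fin n → SignType)} (hg : Good G C S g) :
    ∃ a₀ a m, Admissible G C S a₀ a m ∧ Attained G C S a₀ a m ∧ faceData G C S a₀ a m = g := by
  classical
  obtain ⟨u, v, ρ⟩ := g
  simp only [Good] at hg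
  set N : ℝ := ∑ s ∈ S, |(ρ s : ℝ)| with hN
  have hN0 : 0 ≤ N := sum_nonneg fun _ _ => abs_nonneg _
  obtain ⟨p, q, m, hpq, hp, hq, hpu, hqv, h2m, h2m'⟩ : ∃ p q m : ℝ, p + q = N ∧ p ≤ m ∧ q ≤ m ∧
      (p = m ↔ u = true) ∧ (q = m ↔ v = true) ∧ N ≤ 2 * m ∧
      (¬ (u = true ∧ v = true) → N < 2 * m) := by
    rcases u with _ | _ <;> rcases v with _ | _
    on_goal 1 => use N / 2, N / 2, N + 1
    on_goal 2 => use -1, N + 1, N + 1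
    on_goal 3 => use N + 1, -1, N + 1
    on_goal 4 => use N / 2, N / 2, N / 2
    all_goals
      refine ⟨?_, ?_, ?_, ?_, ?_, ?_, ?_⟩ <;>
      first
      | linarith
      | exact fun _ => by linarith
      | exact iff_of_false (fun _ => by linarith) (by decide)
      | simp
  set P : Finset (Fin n) → ℝ := fun K => ∑ s ∈ S with NbrFree G K s, max (ρ s : ℝ) 0 with hP
  set Q : Finset (Fin n) → ℝ := fun K => ∑ s ∈ S with NbrFree G K s, max (-(ρ s : ℝ)) 0 with hQ
  set a₀ : ℝ := p - P ∅ with ha₀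
  set a : Fin n → ℝ := fun i => if i ∈ C then
      if ρ i = 1 then m - a₀ - P {i} else if ρ i = -1 then -a₀ + Q {i} - m
      else -a₀ + (Q {i} - P {i}) / 2
    else (ρ i : ℝ) with ha
  have haS : ∀ s ∈ S, a s = ρ s := fun s hs => if_neg (disjoint_right.1 hdisj hs)
  have htop : ∀ K, top G S a₀ a K = a₀ + ∑ c ∈ K, a c + P K := fun K => by
    rw [top, hP]
    congr 1
    exact sum_congr rfl fun s hs => by rw [haS s (mem_filter.1 hs).1]
  have htop' : ∀ K, top G S (-a₀) (-a) K = -a₀ - ∑ c ∈ K, a c + Q K := fun K => by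
    simp only [top, hQ, Pi.neg_apply, sum_neg_distrib, ← sub_eq_add_neg]
    congr 1
    exact sum_congr rfl fun s hs => by rw [haS s (mem_filter.1 hs).1]
  have hNa : ∑ s ∈ S, |a s| = N := sum_congr rfl fun s hs => by rw [haS s hs]
  have e₀ := top_empty_add_top_neg (G := G) (S := S) a₀ a
  rw [hNa] at e₀
  have hp' : top G S a₀ a ∅ = p := by rw [htop, sum_empty, ha₀]; ring
  have hq' : top G S (-a₀) (-a) ∅ = q := by linarith
  have hR : ∀ c, top G S a₀ a {c} + top G S (-a₀) (-a) {c} ≤ 2 * m := fun c => by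
    have e := top_singleton_add_top_neg (G := G) (S := S) a₀ a c
    have : 0 ≤ ∑ s ∈ S with G.Adj c s, |a s| := sum_nonneg fun _ _ => abs_nonneg _
    linarith
  have hR' : ∀ c ∈ C, ρ c ≠ 0 → top G S a₀ a {c} + top G S (-a₀) (-a) {c} < 2 * m := by
    intro c hc hρ
    have e := top_singleton_add_top_neg (G := G) (S := S) a₀ a c
    have h0 : 0 ≤ ∑ s ∈ S with G.Adj c s, |a s| := sum_nonneg fun _ _ => abs_nonneg _
    by_cases huv : u = true ∧ v = true
    · obtain ⟨s, hs, hs', hcs⟩ := hg.1 huv.1 huv.2 c hc hρ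
      have h1 : 0 < ∑ s ∈ S with G.Adj c s, |a s| := by
        refine sum_pos' (fun _ _ => abs_nonneg _) ⟨s, mem_filter.2 ⟨hs, hcs⟩, ?_⟩
        rw [haS s hs, abs_pos]
        revert hs'
        cases ρ s <;> simp
      linarith
    · linarith [h2m' huv]
  have hpos : ∀ c ∈ C, ρ c = 1 → top G S a₀ a {c} = m := by
    intro c hc h
    have hac : a c = m - a₀ - P {c} := (if_pos hc).trans (if_pos h)
    rw [htop, sum_singleton, hac]
    ring
  have hneg : ∀ c ∈ C, ρ c = -1 → top G S (-a₀) (-a) {c} = m := by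
    intro c hc h
    have h' : ρ c ≠ 1 := by rw [h]; decide
    have hac : a c = -a₀ + Q {c} - m := (if_pos hc).trans ((if_neg h').trans (if_pos h))
    rw [htop', sum_singleton, hac]
    ring
  have hzero : ∀ c ∈ C, ρ c = 0 → top G S a₀ a {c} = top G S (-a₀) (-a) {c} := by
    intro c hc h
    have h' : ρ c ≠ 1 := by rw [h]; decide
    have h'' : ρ c ≠ -1 := by rw [h]; decide
    have hac : a c = -a₀ + (Q {c} - P {c}) / 2 :=
      (if_pos hc).trans ((if_neg h').trans (if_neg h''))
    rw [htop, htop', sum_singleton, hac]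
    ring
  have hsign : ∀ x : SignType, x = 0 ∨ x = -1 ∨ x = 1 := by decide
  have hattain : ∀ c ∈ C, ρ c ≠ 0 → top G S a₀ a {c} = m ∨ top G S (-a₀) (-a) {c} = m := by
    intro c hc h
    rcases hsign (ρ c) with h' | h' | h'
    · exact absurd h' h
    · exact Or.inr (hneg c hc h')
    · exact Or.inl (hpos c hc h')
  have hle : ∀ c ∈ C, top G S a₀ a {c} ≤ m ∧ top G S (-a₀) (-a) {c} ≤ m := by
    intro c hc
    have := hR c
    rcases hsign (ρ c) with h' | h' | h'
    · have := hzero c hc h'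
      constructor <;> linarith
    · have := hneg c hc h'
      constructor <;> linarith
    · have := hpos c hc h'
      constructor <;> linarith
  refine ⟨a₀, a, m, ⟨hp'.trans_le hp, hq'.trans_le hq, fun c hc => (hle c hc).1,
    fun c hc => (hle c hc).2⟩, ?_, ?_⟩
  · rw [Attained, hp', hq', hpu, hqv]
    by_cases hu : u = true
    · exact Or.inl hu
    by_cases hv : v = true
    · exact Or.inr (Or.inl hv)
    obtain ⟨⟨c, hc, hc'⟩, -⟩ := hg.2 (by simpa using hu) (by simpa using hv)
    exact Or.inr (Or.inr ⟨c, hc, hattain c hc hc'⟩)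
  · refine Prod.ext ?_ (Prod.ext ?_ ?_)
    · simp [faceData, hp', hpu]
    · simp [faceData, hq', hqv]
    · funext i
      simp only [faceData]
      by_cases hi : i ∈ C
      · have h₁ := hR' i hi
        rcases hsign (ρ i) with h' | h' | h' <;> rw [h'] at h₁ ⊢
        · rw [signs_eq_zero_iff hi, hzero i hi h']
        · rw [signs_eq_neg_one_iff hi]
          have := hneg i hi h'
          have := h₁ (by decide)
          exact ⟨by assumption, fun _ => by linarith⟩
        · rw [signs_eq_one_iff hi]
          have := hpos i hi h'
          have := h₁ (by decide)
          exact ⟨by assumption, fun _ => by linarith⟩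
      · have hiS : i ∈ S := by
          have := mem_univ i
          rw [← hcover, mem_union] at this
          exact this.resolve_left hi
        rw [signs, if_neg hi, haS i hiS]
        simp only [hp', hq', hpu, hqv]
        split_ifs with h
        · cases ρ i <;> simp
        · push Not at h
          by_contra hρ
          obtain ⟨-, h'⟩ := hg.2 (by simpa using h.1) (by simpa using h.2.1)
          obtain ⟨c, hc, hc', hci⟩ := h' i hiS (Ne.symm hρ)
          exact hci (h.2.2 c hc (hattain c hc hc'))

lemma fill_mem_halfFace (hdisj : Disjoint C S) (hS : IsStable G S) {u v : Bool}
    {ρ : Fin n → SignType} {K : Finset (Fin n)} (hK : K ⊆ C) (hK' : K = ∅ ∨ ∃ c, K = {c})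
    (hu : K = ∅ → u = true) (ht : ∀ c ∈ K, Touches G S u v ρ c) {p : Fin n → Prop}
    (hp : ∀ s, 0 < ρ s → p s) (hn : ∀ s, ρ s < 0 → ¬ p s) :
    fill G S K p ∈ halfFace G C S u v ρ :=
  ⟨isStable_fill hS hK' p, by rwa [fill_inter hdisj hK], by rwa [fill_inter hdisj hK],
    tight_fill hdisj hK hp hn⟩

lemma eq_true_iff (hdisj : Disjoint C S) (hS : IsStable G S) {u v : Bool}
    {ρ : Fin n → SignType} : u = true ↔ ∃ I ∈ halfFace G C S u v ρ, I ∩ C = ∅ := by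
  constructor
  · intro hu
    exact ⟨_, fill_mem_halfFace hdisj hS (empty_subset C) (Or.inl rfl) (fun _ => hu) (by simp)
      (fun _ => id) fun _ => lt_asymm, fill_inter hdisj (empty_subset C) _⟩
  · rintro ⟨I, hI, hI'⟩
    exact hI.2.1 hI'

lemma touches_iff_exists (hdisj : Disjoint C S) (hS : IsStable G S) {u v : Bool}
    {ρ : Fin n → SignType} {c : Fin n} (hc : c ∈ C) :
    Touches G S u v ρ c ↔ ∃ I ∈ halfFace G C S u v ρ, c ∈ I := by
  constructor
  · intro h
    exact ⟨_, fill_mem_halfFace hdisj hS (singleton_subset_iff.2 hc) (Or.inr ⟨c, rfl⟩) (by simp)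
      (by simpa using h) (fun _ => id) fun _ => lt_asymm, mem_fill.2 (by simp)⟩
  · rintro ⟨I, hI, hI'⟩
    exact hI.2.2.1 c (mem_inter.2 ⟨hI', hc⟩)

lemma sign_imp_of_halfFace_eq (hdisj : Disjoint C S) (hS : IsStable G S) {u v u' v' : Bool}
    {ρ ρ' : Fin n → SignType} (h : halfFace G C S u v ρ = halfFace G C S u' v' ρ')
    {K : Finset (Fin n)} (hK : K ⊆ C) (hK' : K = ∅ ∨ ∃ c, K = {c})
    (hu : K = ∅ → u = true) (ht : ∀ c ∈ K, Touches G S u v ρ c) {s : Fin n} (hs : s ∈ S)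
    (hf : NbrFree G K s) : (0 < ρ' s → 0 < ρ s) ∧ (ρ' s < 0 → ρ s < 0) := by
  have hsK : s ∉ K := fun h' => disjoint_left.1 hdisj (hK h') hs
  have h₁ := fill_mem_halfFace (p := fun s => 0 < ρ s) hdisj hS hK hK' hu ht (fun _ => id)
    fun _ => lt_asymm
  have h₂ := fill_mem_halfFace (p := fun s => ¬ ρ s < 0) hdisj hS hK hK' hu ht (fun _ => lt_asymm)
    fun _ => not_not_intro
  rw [h] at h₁ h₂
  have h₃ := (h₁.2.2.2 s hs (by rwa [fill_inter hdisj hK])).1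
  have h₄ := (h₂.2.2.2 s hs (by rwa [fill_inter hdisj hK])).2
  rw [mem_fill] at h₃ h₄
  constructor
  · intro h'
    exact ((h₃ h').resolve_left hsK).2.2
  · intro h'
    by_contra h''
    exact h₄ h' (Or.inr ⟨hs, hf, h''⟩)

lemma touches_and_touches_neg {u v : Bool} {ρ : Fin n → SignType} {c : Fin n}
    (h₁ : Touches G S u v ρ c) (h₂ : Touches G S v u (-ρ) c) : ρ c = 0 := by
  rcases h₁ with h₁ | h₁
  · rcases h₂ with h₂ | h₂
    · rw [Pi.neg_apply, h₁] at h₂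
      exact absurd h₂ (by decide)
    · simpa using h₂.2.2.1
  · exact h₁.2.2.1

lemma eq_one_iff_touches {u v : Bool} {ρ : Fin n → SignType} {c : Fin n} :
    ρ c = 1 ↔ Touches G S u v ρ c ∧ ¬ Touches G S v u (-ρ) c := by
  constructor
  · refine fun h => ⟨Or.inl h, fun h' => ?_⟩
    have := touches_and_touches_neg (Or.inl h) h'
    rw [h] at this
    exact absurd this (by decide)
  · rintro ⟨h | ⟨hu, hv, h, h'⟩, h''⟩
    · exact h
    · exact absurd (Or.inr ⟨hv, hu, by simpa using h, by simpa using h'⟩) h''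

lemma sign_ext {x y : SignType} (h₁ : 0 < x ↔ 0 < y) (h₂ : x < 0 ↔ y < 0) : x = y := by
  revert x y
  decide

lemma sign_ext_eq {x y : SignType} (h₁ : x = 1 ↔ y = 1) (h₂ : -x = 1 ↔ -y = 1) : x = y := by
  revert x y
  decide

lemma face_injOn (hdisj : Disjoint C S) (hcover : C ∪ S = univ) (hS : IsStable G S) :
    Set.InjOn (face G C S) {g | Good G C S g} := by
  rintro ⟨u, v, ρ⟩ hg ⟨u', v', ρ'⟩ hg' h
  obtain ⟨h₁, h₂⟩ := Prod.ext_iff.1 h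
  simp only [face] at h₁ h₂
  have hu : u = u' := by
    rw [Bool.eq_iff_iff, eq_true_iff hdisj hS, h₁, ← eq_true_iff hdisj hS]
  have hv : v = v' := by
    rw [Bool.eq_iff_iff, eq_true_iff hdisj hS, h₂, ← eq_true_iff hdisj hS]
  subst hu hv
  have ht : ∀ c ∈ C, (Touches G S u v ρ c ↔ Touches G S u v ρ' c) := fun c hc => by
    rw [touches_iff_exists hdisj hS hc, h₁, ← touches_iff_exists hdisj hS hc]
  have ht' : ∀ c ∈ C, (Touches G S v u (-ρ) c ↔ Touches G S v u (-ρ') c) := fun c hc => by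
    rw [touches_iff_exists hdisj hS hc, h₂, ← touches_iff_exists hdisj hS hc]
  have hρC : ∀ c ∈ C, ρ c = ρ' c := fun c hc => by
    have e₁ := eq_one_iff_touches (G := G) (S := S) (u := u) (v := v) (ρ := ρ) (c := c)
    have e₂ := eq_one_iff_touches (G := G) (S := S) (u := u) (v := v) (ρ := ρ') (c := c)
    have e₃ := eq_one_iff_touches (G := G) (S := S) (u := v) (v := u) (ρ := -ρ) (c := c)
    have e₄ := eq_one_iff_touches (G := G) (S := S) (u := v) (v := u) (ρ := -ρ') (c := c)
    rw [neg_neg] at e₃ e₄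
    exact sign_ext_eq (by rw [e₁, e₂, ht c hc, ht' c hc])
      (by rw [← Pi.neg_apply, ← Pi.neg_apply, e₃, e₄, ht c hc, ht' c hc])
  have pos : ∀ K ⊆ C, (K = ∅ ∨ ∃ c, K = {c}) → (K = ∅ → u = true) →
      (∀ c ∈ K, Touches G S u v ρ c) → ∀ s ∈ S, NbrFree G K s → ρ s = ρ' s := by
    intro K hK hK' hKu hKt s hs hf
    have i₁ := sign_imp_of_halfFace_eq hdisj hS h₁ hK hK' hKu hKt hs hf
    have i₂ := sign_imp_of_halfFace_eq hdisj hS h₁.symm hK hK' hKu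
      (fun c hc => (ht c (hK hc)).1 (hKt c hc)) hs hf
    exact sign_ext ⟨i₂.1, i₁.1⟩ ⟨i₂.2, i₁.2⟩
  have neg : ∀ K ⊆ C, (K = ∅ ∨ ∃ c, K = {c}) → (K = ∅ → v = true) →
      (∀ c ∈ K, Touches G S v u (-ρ) c) → ∀ s ∈ S, NbrFree G K s → ρ s = ρ' s := by
    intro K hK hK' hKu hKt s hs hf
    have i₁ := sign_imp_of_halfFace_eq hdisj hS h₂ hK hK' hKu hKt hs hf
    have i₂ := sign_imp_of_halfFace_eq hdisj hS h₂.symm hK hK' hKu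
      (fun c hc => (ht' c (hK hc)).1 (hKt c hc)) hs hf
    exact neg_injective (sign_ext ⟨i₂.1, i₁.1⟩ ⟨i₂.2, i₁.2⟩)
  have vis : ∀ s ∈ S, (∃ c ∈ C, ρ c ≠ 0 ∧ ¬ G.Adj c s) → ρ s = ρ' s := by
    rintro s hs ⟨c, hc, hρ, hcs⟩
    have hsign : ∀ x : SignType, x ≠ 0 → x = 1 ∨ -x = 1 := by decide
    rcases hsign _ hρ with h' | h'
    · exact pos {c} (singleton_subset_iff.2 hc) (Or.inr ⟨c, rfl⟩) (by simp)
        (fun d hd => by rw [mem_singleton] at hd; subst hd; exact Or.inl h') s hs (by simpa [NbrFree] using hcs)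
    · exact neg {c} (singleton_subset_iff.2 hc) (Or.inr ⟨c, rfl⟩) (by simp)
        (fun d hd => by rw [mem_singleton] at hd; subst hd; exact Or.inl h') s hs
        (by simpa [NbrFree] using hcs)
  have hρS : ∀ s ∈ S, ρ s = ρ' s := by
    intro s hs
    cases u with
    | true => exact pos ∅ (empty_subset C) (Or.inl rfl) (by simp) (by simp) s hs (by simp [NbrFree])
    | false =>
      cases v with
      | true =>
        exact neg ∅ (empty_subset C) (Or.inl rfl) (by simp) (by simp) s hs (by simp [NbrFree])
      | false =>
        by_cases h0 : ρ s = 0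
        · by_cases h0' : ρ' s = 0
          · rw [h0, h0']
          · obtain ⟨c, hc, hc', hcs⟩ := (hg'.2 rfl rfl).2 s hs h0'
            exact vis s hs ⟨c, hc, by rwa [hρC c hc], hcs⟩
        · exact vis s hs ((hg.2 rfl rfl).2 s hs h0)
  have hρ : ρ = ρ' := funext fun i => by
    have := mem_univ i
    rw [← hcover, mem_union] at this
    exact this.elim (hρC i) (hρS i)
  rw [hρ]

lemma exists_sum_eq_top (hdisj : Disjoint C S) (hcover : C ∪ S = univ) (hS : IsStable G S)
    (a₀ : ℝ) (a : Fin n → ℝ) {K : Finset (Fin n)} (hK : K = ∅ ∨ ∃ c ∈ C, K = {c}) :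
    ∃ I, IsStable G I ∧ a₀ + ∑ i ∈ I, a i = top G S a₀ a K := by
  have hKC : K ⊆ C := by
    rcases hK with rfl | ⟨c, hc, rfl⟩
    · exact empty_subset C
    · exact singleton_subset_iff.2 hc
  have hst : IsStable G (fill G S K (0 < a ·)) :=
    isStable_fill hS (hK.imp_right fun ⟨c, _, h⟩ => ⟨c, h⟩) _
  refine ⟨_, hst, ?_⟩
  rw [(sum_eq_top_iff hdisj hcover hst a₀ a).2
    (tight_fill hdisj hKC (fun _ => id) fun _ => lt_asymm), fill_inter hdisj hKC]

lemma neg_add_sum (a₀ : ℝ) (a : Fin n → ℝ) (I : Finset (Fin n)) :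
    -a₀ + ∑ i ∈ I, (-a) i = -(a₀ + ∑ i ∈ I, a i) := by
  simp [add_comm]

lemma admissible_iff (hdisj : Disjoint C S) (hcover : C ∪ S = univ)
    (hC : G.IsClique (↑C : Set (Fin n))) (hS : IsStable G S) {a₀ : ℝ} {a : Fin n → ℝ} {m : ℝ} :
    Admissible G C S a₀ a m ↔
      ∀ I, IsStable G I → a₀ + ∑ i ∈ I, a i ≤ m ∧ -(a₀ + ∑ i ∈ I, a i) ≤ m := by
  constructor
  · intro h I hI
    rw [← neg_add_sum]
    exact ⟨(sum_le_top hdisj hcover hI a₀ a).trans (h.top_inter_le hC hI),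
      (sum_le_top hdisj hcover hI (-a₀) (-a)).trans (h.neg.top_inter_le hC hI)⟩
  · intro h
    have h₁ : ∀ K : Finset (Fin n), (K = ∅ ∨ ∃ c ∈ C, K = {c}) →
        top G S a₀ a K ≤ m ∧ top G S (-a₀) (-a) K ≤ m := by
      intro K hK
      obtain ⟨I, hI, hI'⟩ := exists_sum_eq_top hdisj hcover hS a₀ a hK
      obtain ⟨J, hJ, hJ'⟩ := exists_sum_eq_top hdisj hcover hS (-a₀) (-a) hK
      rw [neg_add_sum] at hJ'
      exact ⟨hI' ▸ (h I hI).1, hJ' ▸ (h J hJ).2⟩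
    exact ⟨(h₁ _ (Or.inl rfl)).1, (h₁ _ (Or.inl rfl)).2,
      fun c hc => (h₁ _ (Or.inr ⟨c, hc, rfl⟩)).1, fun c hc => (h₁ _ (Or.inr ⟨c, hc, rfl⟩)).2⟩

lemma Admissible.attained_iff {a₀ : ℝ} {a : Fin n → ℝ} {m : ℝ} (h : Admissible G C S a₀ a m)
    (hdisj : Disjoint C S) (hcover : C ∪ S = univ)
    (hC : G.IsClique (↑C : Set (Fin n))) (hS : IsStable G S) :
    Attained G C S a₀ a m ↔
      ∃ I, IsStable G I ∧ (a₀ + ∑ i ∈ I, a i = m ∨ -(a₀ + ∑ i ∈ I, a i) = m) := by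
  constructor
  · have h₁ : ∀ K : Finset (Fin n), (K = ∅ ∨ ∃ c ∈ C, K = {c}) →
        (top G S a₀ a K = m ∨ top G S (-a₀) (-a) K = m) →
        ∃ I, IsStable G I ∧ (a₀ + ∑ i ∈ I, a i = m ∨ -(a₀ + ∑ i ∈ I, a i) = m) := by
      rintro K hK (hm | hm)
      · obtain ⟨I, hI, hI'⟩ := exists_sum_eq_top hdisj hcover hS a₀ a hK
        exact ⟨I, hI, Or.inl (hI'.trans hm)⟩
      · obtain ⟨I, hI, hI'⟩ := exists_sum_eq_top hdisj hcover hS (-a₀) (-a) hK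
        rw [neg_add_sum] at hI'
        exact ⟨I, hI, Or.inr (hI'.trans hm)⟩
    rintro (hm | hm | ⟨c, hc, hm⟩)
    · exact h₁ ∅ (Or.inl rfl) (Or.inl hm)
    · exact h₁ ∅ (Or.inl rfl) (Or.inr hm)
    · exact h₁ {c} (Or.inr ⟨c, hc, rfl⟩) hm
  · rintro ⟨I, hI, hm⟩
    have h₂ : top G S a₀ a (I ∩ C) = m ∨ top G S (-a₀) (-a) (I ∩ C) = m := by
      rw [← neg_add_sum] at hm
      exact hm.imp (fun hm => ((sum_eq_iff hdisj hcover hI (h.top_inter_le hC hI)).1 hm).1)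
        fun hm => ((sum_eq_iff hdisj hcover hI (h.neg.top_inter_le hC hI)).1 hm).1
    rcases inter_eq_empty_or_singleton hC hI with h' | ⟨c, hc, h'⟩
    · rw [h'] at h₂
      rcases h₂ with h₂ | h₂
      · exact Or.inl h₂
      · exact Or.inr (Or.inl h₂)
    · rw [h'] at h₂
      exact Or.inr (Or.inr ⟨c, hc, h₂⟩)

lemma map_hansenVert (l : StrongDual ℝ (Fin (n + 1) → ℝ)) (I : Finset (Fin n)) :
    l (hansenVert I) = l (Pi.single 0 1) + ∑ i ∈ I, l (Pi.single i.succ 1) := by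
  have : hansenVert I = Pi.single 0 1 + ∑ i ∈ I, Pi.single i.succ 1 := by
    ext j
    refine Fin.cases ?_ (fun i => ?_) j
    · simp [hansenVert, Finset.sum_apply]
    · simp [hansenVert, Finset.sum_apply, Pi.single_apply]
  rw [this, map_add, map_sum]

lemma exists_strongDual (a₀ : ℝ) (a : Fin n → ℝ) : ∃ l : StrongDual ℝ (Fin (n + 1) → ℝ),
    ∀ I, l (hansenVert I) = a₀ + ∑ i ∈ I, a i := by
  refine ⟨a₀ • ContinuousLinearMap.proj 0 + ∑ i, a i • ContinuousLinearMap.proj (i.succ),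
    fun I => ?_⟩
  simp [hansenVert]

variable (G) in
/-- The points `±(e₀ + ∑_{i ∈ I} e_i)` spanning the Hansen polytope. -/
def vertices : Set (Fin (n + 1) → ℝ) :=
  {x | ∃ I : Finset (Fin n), IsStable G I ∧ (x = hansenVert I ∨ x = -hansenVert I)}

variable (G) in
/-- The stable sets indexing the positive and the negative vertices in `F`. -/
def vertexSets (F : Set (Fin (n + 1) → ℝ)) : Set (Finset (Fin n)) × Set (Finset (Fin n)) :=
  ({I | IsStable G I ∧ hansenVert I ∈ F}, {I | IsStable G I ∧ -hansenVert I ∈ F})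

lemma finite_vertices : (vertices G).Finite := by
  refine (((Set.finite_range (hansenVert (n := n))).union
    (Set.finite_range fun I : Finset (Fin n) => -hansenVert I))).subset ?_
  rintro x ⟨I, -, rfl | rfl⟩
  · exact Or.inl ⟨I, rfl⟩
  · exact Or.inr ⟨I, rfl⟩

lemma hansenPolytope_le_iff (l : StrongDual ℝ (Fin (n + 1) → ℝ)) (m : ℝ) :
    (∀ x ∈ hansenPolytope G, l x ≤ m) ↔
      ∀ I, IsStable G I → l (hansenVert I) ≤ m ∧ -l (hansenVert I) ≤ m := by
  constructor
  · intro h I hI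
    rw [← map_neg]
    exact ⟨h _ (subset_convexHull ℝ _ ⟨I, hI, Or.inl rfl⟩),
      h _ (subset_convexHull ℝ _ ⟨I, hI, Or.inr rfl⟩)⟩
  · intro h
    refine convexHull_min (t := {x | l x ≤ m}) ?_ (convex_halfSpace_le l.isLinear m)
    rintro x ⟨I, hI, rfl | rfl⟩
    · exact (h I hI).1
    · exact (map_neg l (hansenVert I)).trans_le (h I hI).2

lemma eq_closure_of_isExposed {F : Set (Fin (n + 1) → ℝ)}
    (hF : IsExposed ℝ (hansenPolytope G) F) :
    F = closure (convexHull ℝ (F ∩ vertices G)) := by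
  have hc : IsCompact (hansenPolytope G) := finite_vertices.isCompact_convexHull (𝕜 := ℝ)
  have hFc : IsCompact F := hF.isCompact hc
  have hFv : Convex ℝ F := hF.convex (convex_convexHull ℝ _)
  refine Set.Subset.antisymm ?_ ?_
  · conv_lhs => rw [← closure_convexHull_extremePoints hFc hFv]
    refine closure_mono (convexHull_mono (Set.subset_inter (extremePoints_subset (𝕜 := ℝ)) ?_))
    exact hF.isExtreme.extremePoints_subset_extremePoints.trans
      (extremePoints_convexHull_subset (𝕜 := ℝ))
  · exact closure_minimal (convexHull_min Set.inter_subset_left hFv) hFc.isClosed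

lemma inter_vertices_eq (F : Set (Fin (n + 1) → ℝ)) : F ∩ vertices G =
    hansenVert '' (vertexSets G F).1 ∪ (fun I => -hansenVert I) '' (vertexSets G F).2 := by
  ext x
  constructor
  · rintro ⟨hx, I, hI, rfl | rfl⟩
    · exact Or.inl ⟨I, ⟨hI, hx⟩, rfl⟩
    · exact Or.inr ⟨I, ⟨hI, hx⟩, rfl⟩
  · rintro (⟨I, ⟨hI, hx⟩, rfl⟩ | ⟨I, ⟨hI, hx⟩, rfl⟩)
    · exact ⟨hx, I, hI, Or.inl rfl⟩
    · exact ⟨hx, I, hI, Or.inr rfl⟩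

lemma vertexSets_injOn :
    Set.InjOn (vertexSets G) {F | IsExposed ℝ (hansenPolytope G) F ∧ F.Nonempty} := by
  intro F hF F' hF' h
  rw [eq_closure_of_isExposed hF.1, eq_closure_of_isExposed hF'.1, inter_vertices_eq,
    inter_vertices_eq, h]

lemma exists_mem_of_isExposed {F : Set (Fin (n + 1) → ℝ)}
    (hF : IsExposed ℝ (hansenPolytope G) F) (hne : F.Nonempty) :
    ∃ I, IsStable G I ∧ (hansenVert I ∈ F ∨ -hansenVert I ∈ F) := by
  rw [eq_closure_of_isExposed hF, closure_nonempty_iff, convexHull_nonempty_iff] at hne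
  obtain ⟨x, hx, I, hI, rfl | rfl⟩ := hne
  · exact ⟨I, hI, Or.inl hx⟩
  · exact ⟨I, hI, Or.inr hx⟩

lemma vertexSets_of_le {l : StrongDual ℝ (Fin (n + 1) → ℝ)} {m : ℝ} :
    vertexSets G {x ∈ hansenPolytope G | l x = m} =
      ({I | IsStable G I ∧ l (hansenVert I) = m}, {I | IsStable G I ∧ -l (hansenVert I) = m}) := by
  refine Prod.ext ?_ ?_ <;> ext I <;> refine and_congr_right fun hI => ?_
  · exact and_iff_right (subset_convexHull ℝ _ ⟨I, hI, Or.inl rfl⟩)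
  · rw [← map_neg]
    exact and_iff_right (subset_convexHull ℝ _ ⟨I, hI, Or.inr rfl⟩)

lemma sep_max_eq {E : Type*} {P : Set E} {f : E → ℝ} {x₀ : E} (hx₀ : x₀ ∈ P)
    (h : ∀ y ∈ P, f y ≤ f x₀) : {x ∈ P | ∀ y ∈ P, f y ≤ f x} = {x ∈ P | f x = f x₀} := by
  ext x
  refine and_congr_right fun hx => ⟨fun h' => (h x hx).antisymm (h' x₀ hx₀), fun h' => ?_⟩
  rwa [h']

lemma image_vertexSets (hdisj : Disjoint C S) (hcover : C ∪ S = univ)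
    (hC : G.IsClique (↑C : Set (Fin n))) (hS : IsStable G S) :
    vertexSets G '' {F | IsExposed ℝ (hansenPolytope G) F ∧ F.Nonempty} =
      face G C S '' {g | Good G C S g} := by
  apply Set.Subset.antisymm
  · rintro _ ⟨F, ⟨hF, hne⟩, rfl⟩
    obtain ⟨l, hl⟩ := hF hne
    obtain ⟨x₀, hx₀⟩ := hne
    have hx₀' := hl ▸ hx₀
    rw [sep_max_eq hx₀'.1 hx₀'.2] at hl
    have hadm : Admissible G C S (l (Pi.single 0 1)) (fun i => l (Pi.single i.succ 1)) (l x₀) := by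
      rw [admissible_iff hdisj hcover hC hS]
      simp only [← map_hansenVert]
      exact (hansenPolytope_le_iff l _).1 hx₀'.2
    refine ⟨faceData G C S (l (Pi.single 0 1)) (fun i => l (Pi.single i.succ 1)) (l x₀),
      hadm.good hdisj ?_, ?_⟩
    · rw [hadm.attained_iff hdisj hcover hC hS]
      obtain ⟨I, hI, h⟩ := exists_mem_of_isExposed hF ⟨x₀, hx₀⟩
      rw [hl] at h
      simp only [← map_hansenVert]
      exact ⟨I, hI, h.imp (fun h => h.2) fun h => (map_neg l _).symm.trans h.2⟩
    · rw [hadm.face_eq hdisj hcover hC, hl, vertexSets_of_le]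
      simp only [← map_hansenVert]
  · rintro _ ⟨g, hg, rfl⟩
    obtain ⟨a₀, a, m, hadm, hatt, rfl⟩ := exists_faceData_eq hdisj hcover hg
    obtain ⟨l, hl⟩ := exists_strongDual a₀ a
    rw [hadm.attained_iff hdisj hcover hC hS] at hatt
    have hle : ∀ x ∈ hansenPolytope G, l x ≤ m := by
      rw [hansenPolytope_le_iff]
      simpa only [hl] using (admissible_iff hdisj hcover hC hS).1 hadm
    obtain ⟨x₀, hx₀, rfl⟩ : ∃ x₀ ∈ hansenPolytope G, l x₀ = m := by
      obtain ⟨I, hI, h | h⟩ := hatt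
      · exact ⟨_, subset_convexHull ℝ _ ⟨I, hI, Or.inl rfl⟩, (hl I).trans h⟩
      · exact ⟨_, subset_convexHull ℝ _ ⟨I, hI, Or.inr rfl⟩, by rw [map_neg, hl, h]⟩
    refine ⟨{x ∈ hansenPolytope G | l x = l x₀},
      ⟨fun _ => ⟨l, (sep_max_eq hx₀ hle).symm⟩, x₀, hx₀, rfl⟩, ?_⟩
    rw [hadm.face_eq hdisj hcover hC, vertexSets_of_le]
    simp only [hl]

lemma nbrCond_or_nonNbrCond (ρ : Fin n → SignType) : NbrCond G C S ρ ∨ NonNbrCond G C S ρ := by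
  by_contra! h
  obtain ⟨h₁, h₂⟩ := h
  simp only [NbrCond, not_forall, not_exists, not_and] at h₁
  obtain ⟨c, hc, hρ, h₁⟩ := h₁
  exact h₂ ⟨⟨c, hc, hρ⟩, fun s hs hs' => ⟨c, hc, hρ, h₁ s hs hs'⟩⟩

open Classical in
lemma card_good : Set.ncard {g | Good G C S g} = 3 ^ (n + 1) +
    Set.ncard {ρ | NbrCond G C S ρ ∧ NonNbrCond G C S ρ} := by
  have h₁ : ({ρ | NbrCond G C S ρ} : Finset (Fin n → SignType)).card +
      ({ρ | NonNbrCond G C S ρ} : Finset (Fin n → SignType)).card =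
      3 ^ n + ({ρ | NbrCond G C S ρ ∧ NonNbrCond G C S ρ} : Finset (Fin n → SignType)).card := by
    rw [← card_union_add_card_inter, ← filter_or, ← filter_and,
      filter_true_of_mem fun ρ _ => nbrCond_or_nonNbrCond ρ, card_univ, Fintype.card_fun,
      Fintype.card_fin]
    rfl
  have h₂ : ({g | Good G C S g} : Finset (Bool × Bool × (Fin n → SignType))).card =
      ({ρ | NbrCond G C S ρ} : Finset (Fin n → SignType)).card + 3 ^ n + (3 ^ n +
      ({ρ | NonNbrCond G C S ρ} : Finset (Fin n → SignType)).card) := by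
    have h₃ : Fintype.card SignType = 3 := rfl
    rw [card_filter, Fintype.sum_prod_type, Fintype.sum_bool, Fintype.sum_prod_type,
      Fintype.sum_prod_type, Fintype.sum_bool, Fintype.sum_bool]
    simp [Good, h₃]
  rw [← coe_filter_univ, ← coe_filter_univ, Set.ncard_coe_finset, Set.ncard_coe_finset, h₂,
    pow_succ]
  linarith

open Classical in
lemma pG_eq (hdisj : Disjoint C S) (hcover : C ∪ S = univ) :
    pG G C S = Set.ncard {ρ | NbrCond G C S ρ ∧ NonNbrCond G C S ρ} := by
  let f : (Fin n → SignType) →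
      Finset (Fin n) × Finset (Fin n) × Finset (Fin n) × Finset (Fin n) := fun ρ =>
    ({c ∈ C | ρ c = 1}, {c ∈ C | ρ c = -1}, {s ∈ S | ρ s = 1}, {s ∈ S | ρ s = -1})
  have hsign : ∀ x : SignType, x = 1 ∨ x = -1 ↔ x ≠ 0 := by decide
  have hmem : ∀ i, i ∈ C ∨ i ∈ S := fun i => by
    rw [← mem_union, hcover]
    exact mem_univ i
  have hf : Function.Injective f := by
    intro ρ ρ' h
    simp only [f, Prod.mk.injEq, Finset.ext_iff, mem_filter] at h
    obtain ⟨h₁, h₂, h₃, h₄⟩ := h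
    have hext : ∀ x y : SignType, (x = 1 ↔ y = 1) → (x = -1 ↔ y = -1) → x = y := by decide
    funext i
    rcases hmem i with hi | hi
    · exact hext _ _ (by simpa [hi] using h₁ i) (by simpa [hi] using h₂ i)
    · exact hext _ _ (by simpa [hi] using h₃ i) (by simpa [hi] using h₄ i)
  rw [← Set.ncard_image_of_injective _ hf, pG]
  congr 1
  have hCu : ∀ ρ : Fin n → SignType, {c ∈ C | ρ c = 1} ∪ {c ∈ C | ρ c = -1} =
      {c ∈ C | ρ c ≠ 0} := fun ρ => by
    simp only [← filter_or, hsign]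
  have hSu : ∀ ρ : Fin n → SignType, {s ∈ S | ρ s = 1} ∪ {s ∈ S | ρ s = -1} =
      {s ∈ S | ρ s ≠ 0} := fun ρ => by
    simp only [← filter_or, hsign]
  have hdis : ∀ (T : Finset (Fin n)) (ρ : Fin n → SignType),
      Disjoint {c ∈ T | ρ c = 1} {c ∈ T | ρ c = -1} := fun T ρ =>
    disjoint_filter.2 fun i _ h => by rw [h]; decide
  have key : ∀ ρ, f ρ ∈ {q : Finset (Fin n) × Finset (Fin n) × Finset (Fin n) × Finset (Fin n) |
      q.1 ⊆ C ∧ q.2.1 ⊆ C ∧ Disjoint q.1 q.2.1 ∧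
      q.2.2.1 ⊆ S ∧ q.2.2.2 ⊆ S ∧ Disjoint q.2.2.1 q.2.2.2 ∧
      ((q.1 ∪ q.2.1).Nonempty ∨ (q.2.2.1 ∪ q.2.2.2).Nonempty) ∧
      (∀ c ∈ q.1 ∪ q.2.1, ∃ s ∈ q.2.2.1 ∪ q.2.2.2, G.Adj c s) ∧
      (∀ s ∈ q.2.2.1 ∪ q.2.2.2, ∃ c ∈ q.1 ∪ q.2.1, ¬ G.Adj c s)} ↔
      NbrCond G C S ρ ∧ NonNbrCond G C S ρ := fun ρ => by
    simp only [Set.mem_ofPred_eq, f, hCu, hSu, filter_subset, hdis, true_and, Finset.Nonempty,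
      mem_filter, NbrCond, NonNbrCond, and_imp, and_assoc]
    constructor
    · rintro ⟨h | ⟨s, hs, h⟩, hA, hB⟩
      · exact ⟨hA, h, hB⟩
      · obtain ⟨c, hc, hc', -⟩ := hB s hs h
        exact ⟨hA, ⟨c, hc, hc'⟩, hB⟩
    · rintro ⟨hA, h, hB⟩
      exact ⟨Or.inl h, hA, hB⟩
  ext q
  constructor
  · intro hq
    obtain ⟨Cp, Cm, Sp, Sm⟩ := q
    obtain ⟨h₁, h₂, h₃, h₄, h₅, h₆, -⟩ := id hq
    dsimp only at h₁ h₂ h₃ h₄ h₅ h₆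
    let ρ : Fin n → SignType := fun i =>
      if i ∈ Cp ∪ Sp then 1 else if i ∈ Cm ∪ Sm then -1 else 0
    have hd : Disjoint (Cp ∪ Sp) (Cm ∪ Sm) := by
      rw [disjoint_union_left, disjoint_union_right, disjoint_union_right]
      exact ⟨⟨h₃, hdisj.mono h₁ h₅⟩, (hdisj.mono h₂ h₄).symm, h₆⟩
    have hρp : ∀ i, ρ i = 1 ↔ i ∈ Cp ∪ Sp := fun i => by
      simp only [ρ]
      split_ifs <;> simp_all
    have hρm : ∀ i, ρ i = -1 ↔ i ∈ Cm ∪ Sm := fun i => by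
      simp only [ρ]
      split_ifs with h h'
      · exact iff_of_false (by decide) (disjoint_left.1 hd h)
      · exact iff_of_true rfl h'
      · exact iff_of_false (by decide) h'
    have haux : ∀ {X Y A B : Finset (Fin n)}, Disjoint X Y → A ⊆ X → B ⊆ Y →
        {i ∈ X | i ∈ A ∪ B} = A := by
      intro X Y A B hXY hA hB
      rw [filter_mem_eq_inter, inter_union_distrib_left, inter_eq_right.2 hA,
        disjoint_iff_inter_eq_empty.1 (hXY.mono_right hB), union_empty]
    have hfρ : f ρ = (Cp, Cm, Sp, Sm) := by
      simp only [f, hρp, hρm]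
      rw [haux hdisj h₁ h₄, haux hdisj h₂ h₅, union_comm Cp, union_comm Cm,
        haux hdisj.symm h₄ h₁, haux hdisj.symm h₅ h₂]
    exact ⟨ρ, (key ρ).1 (hfρ ▸ hq), hfρ⟩
  · rintro ⟨ρ, hρ, rfl⟩
    exact (key ρ).2 hρ

end HansenSplit

open HansenSplit in
/-- Main theorem: for a split graph `G = C ∪ S` on `d − 1` vertices (`d = n + 1`),
the Hansen polytope `H(G) ⊆ ℝ^d` has exactly `3^d + p_G(C,S)` nonempty faces. -/
theorem hansen_split_face_count {n : ℕ} (G : SimpleGraph (Fin n))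
    (C S : Finset (Fin n)) (hdisj : Disjoint C S) (hcover : C ∪ S = Finset.univ)
    (hC : G.IsClique (↑C : Set (Fin n))) (hS : IsStable G S) :
    numFaces (hansenPolytope G) = 3 ^ (n + 1) + pG G C S := by
  rw [pG_eq hdisj hcover, ← card_good, numFaces, ← vertexSets_injOn.ncard_image,
    image_vertexSets hdisj hcover hC hS, (face_injOn hdisj hcover hS).ncard_image]
end
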